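/- Let G be a connected 2P₇-free graph on n ≥ 14 vertices. Then e(G) ≤ max{[n,14,7], 5n − 14}, and equality holds only when n ≥ 22 and G is isomorphic to K₅ + (\overline{K_{n−7}} ∪ K₂). -/

import Mathlib

open SimpleGraph

/-- `H` is contained in `G` as a subgraph, i.e. there is an injective graph
homomorphism from `H` to `G` (a copy of `H` in `G`). -/
def Contains {α β : Type*} (H : SimpleGraph α) (G : SimpleGraph β) : Prop :=
  ∃ f : H →g G, Function.Injective f

/-- `2P₇`: the disjoint union of two copies of the path on 7 vertices. -/
def TwoP7 : SimpleGraph (Fin 7 ⊕ Fin 7) :=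
  SimpleGraph.pathGraph 7 ⊕g SimpleGraph.pathGraph 7

/-- The quantity `[n, m, ℓ]` of the paper: writing `n = (m-1) + t(ℓ-1) + r` with
`t ≥ 0`, `0 ≤ r < ℓ-1`, it equals `C(m-1,2) + t·C(ℓ-1,2) + C(r,2)`;
if `n ≤ m-1` it equals `C(n,2)`. -/
def bracket (n m ℓ : ℕ) : ℕ :=
  if n ≤ m - 1 then n.choose 2
  else (m - 1).choose 2 + ((n - (m - 1)) / (ℓ - 1)) * (ℓ - 1).choose 2
    + ((n - (m - 1)) % (ℓ - 1)).choose 2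

/-- The graph `K₅ + (K₂ ∪ K̄_{n-7})` on `Fin n`: vertices `0,…,4` form a `K₅`
joined to everything, vertices `5,6` form an edge, and vertices `7,…,n-1`
are otherwise isolated. -/
def joinGraph (n : ℕ) : SimpleGraph (Fin n) :=
  SimpleGraph.fromRel (fun u v => u.val < 5 ∨ (u.val ≤ 6 ∧ v.val ≤ 6))

section

open Finset

/-- The sublists of a list that contain no two neighbouring entries. -/
def sparseSublists {α : Type*} : List α → List (List α)
  | [] => [[]]
  | [a] => [[], [a]]
  | a :: b :: l => sparseSublists (b :: l) ++ (sparseSublists l).map (a :: ·)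

theorem filter_mem_sparseSublists {α : Type*} (p : α → Bool) :
    ∀ l : List α, l.IsChain (fun a b => p a → ¬ p b) → l.filter p ∈ sparseSublists l
  | [], _ => by simp [sparseSublists]
  | [a], _ => by by_cases h : p a <;> simp [sparseSublists, h]
  | a :: b :: l, h => by
    obtain ⟨h1, h2⟩ := List.isChain_cons_cons.1 h
    rw [sparseSublists, List.mem_append]
    by_cases ha : p a
    · refine .inr (List.mem_map.2 ⟨_, filter_mem_sparseSublists p l h2.tail, ?_⟩)
      simp [ha, h1 ha]
    · left
      simpa [ha] using filter_mem_sparseSublists p (b :: l) h2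

/-- To check a property of all sets of at least `k` pairwise non-consecutive residues modulo `c`,
it suffices to check an explicit list of sets. -/
theorem forall_sparse {c : ℕ} [NeZero c] (k : ℕ) (P : Finset (ZMod c) → Prop)
    (hP : ∀ s ∈ sparseSublists (List.range c), k ≤ s.length → (0 ∈ s → c - 1 ∉ s) →
      P (s.map (Nat.cast : ℕ → ZMod c)).toFinset)
    (A : Finset (ZMod c)) (hA : ∀ i ∈ A, i + 1 ∉ A) (hk : k ≤ #A) : P A := by
  set s := (List.range c).filter (fun m : ℕ => decide ((m : ZMod c) ∈ A)) with hs
  have hsA : (s.map (Nat.cast : ℕ → ZMod c)).toFinset = A := by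
    ext i
    simp only [hs, List.mem_toFinset, List.mem_filter, List.mem_map, List.mem_range,
      decide_eq_true_eq]
    constructor
    · rintro ⟨m, ⟨-, hm⟩, rfl⟩
      exact hm
    · exact fun hi => ⟨i.val, ⟨i.val_lt, by simpa using hi⟩, by simp⟩
  rw [← hsA]
  refine hP s (filter_mem_sparseSublists _ _ ?_) ?_ ?_
  · rw [List.isChain_range]
    intro m _
    simpa using hA m
  · rw [← hsA] at hk
    exact hk.trans ((List.toFinset_card_le _).trans (by simp))
  · intro h0 h1
    simp only [hs, List.mem_filter, decide_eq_true_eq] at h0 h1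
    refine hA _ h1.2 ?_
    have hc : c - 1 + 1 = c := Nat.succ_pred_eq_of_pos (NeZero.pos c)
    have : ((c - 1 : ℕ) : ZMod c) + 1 = 0 := by
      rw [← Nat.cast_succ, Nat.succ_eq_add_one, hc, ZMod.natCast_self]
    rw [this]
    simpa using h0.2

/-- The residues that are equal to, or at cyclic distance more than `q` from, every member
of `A`. -/
def farFrom {c : ℕ} [NeZero c] (q : ℕ) (A : Finset (ZMod c)) : Finset (ZMod c) :=
  univ.filter fun j => ∀ i ∈ A, j = i ∨ (q < (j - i).val ∧ q < (i - j).val)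

theorem card_farFrom_three_ten : ∀ A : Finset (ZMod 10), (∀ i ∈ A, i + 1 ∉ A) → 3 ≤ #A →
    #(farFrom 3 A) < 3 :=
  forall_sparse 3 _ (by decide +kernel)

theorem card_farFrom_two_ten : ∀ A : Finset (ZMod 10), (∀ i ∈ A, i + 1 ∉ A) → 4 ≤ #A →
    #(farFrom 2 A) < 4 :=
  forall_sparse 4 _ (by decide +kernel)

theorem card_farFrom_two_eleven : ∀ A : Finset (ZMod 11), (∀ i ∈ A, i + 1 ∉ A) → 4 ≤ #A →
    #(farFrom 2 A) < 3 :=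
  forall_sparse 4 _ (by decide +kernel)

theorem sparse_ten : ∀ A : Finset (ZMod 10), (∀ i ∈ A, i + 1 ∉ A) → 5 ≤ #A →
    ∃ t, A = {t, t + 2, t + 4, t + 6, t + 8} :=
  forall_sparse 5 _ (by decide +kernel)

theorem sparse_eleven : ∀ A : Finset (ZMod 11), (∀ i ∈ A, i + 1 ∉ A) → 5 ≤ #A →
    ∃ t, A = {t, t + 2, t + 4, t + 6, t + 8} :=
  forall_sparse 5 _ (by decide +kernel)

/-- The residues modulo `12` at which a second vertex can be attached to a cycle of length `12`
when a first one is attached at `A`. -/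
def compatible (A : Finset (ZMod 12)) : Finset (ZMod 12) :=
  univ.filter fun j => ∀ i ∈ A, j ≠ i + 1 ∧ j ≠ i - 1 ∧ j ≠ i + 4 ∧ j ≠ i - 4 ∧ j ≠ i + 6

/-- The ordered pairs of distinct successors, or of distinct predecessors, of members of `A`. -/
def shiftPairs {c : ℕ} (A : Finset (ZMod c)) : Finset (ZMod c × ZMod c) :=
  A.offDiag.image (fun x => (x.1 + 1, x.2 + 1)) ∪ A.offDiag.image (fun x => (x.1 - 1, x.2 - 1))

theorem card_shiftPairs_twelve : ∀ A : Finset (ZMod 12), (∀ i ∈ A, i + 1 ∉ A) → 4 ≤ #A →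
    (compatible A).Nonempty → #A ≤ 5 ∧ 18 ≤ #(shiftPairs A) ∧
      (#(compatible A) ≤ 3 ∨ (#(compatible A) ≤ 4 ∧ #A ≤ 4 ∧ 22 ≤ #(shiftPairs A))) :=
  forall_sparse 4 _ (by decide +kernel)

theorem card_shiftPairs_eleven : ∀ A : Finset (ZMod 11), (∀ i ∈ A, i + 1 ∉ A) → 4 ≤ #A →
    12 ≤ #(shiftPairs A) :=
  forall_sparse 4 _ (by decide +kernel)

section Counting

variable {V : Type*} (G : SimpleGraph V) [DecidableRel G.Adj]

/-- The number of neighbours of `x` in `B`. -/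
def nbrCount (B : Finset V) (x : V) : ℕ := #(B.filter (G.Adj x))

/-- The degree sum of the subgraph induced by `T`, i.e. twice its number of edges. -/
def degSum (T : Finset V) : ℕ := ∑ x ∈ T, nbrCount G T x

theorem nbrCount_mono {B B' : Finset V} (h : B ⊆ B') (x : V) : nbrCount G B x ≤ nbrCount G B' x :=
  card_le_card (filter_subset_filter _ h)

theorem sum_nbrCount_comm (A B : Finset V) :
    ∑ x ∈ A, nbrCount G B x = ∑ x ∈ B, nbrCount G A x := by
  have h := sum_card_bipartiteAbove_eq_sum_card_bipartiteBelow (s := A) (t := B) G.Adj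
  refine h.trans (sum_congr rfl fun x _ => ?_)
  simp only [bipartiteBelow, nbrCount, G.adj_comm x]

theorem degSum_univ [Fintype V] : degSum G univ = 2 * G.edgeSet.ncard := by
  rw [← coe_edgeFinset, Set.ncard_coe_finset, ← sum_degrees_eq_twice_card_edges]
  refine sum_congr rfl fun x _ => ?_
  rw [nbrCount, ← card_neighborFinset_eq_degree, neighborFinset_eq_filter]

variable [DecidableEq V]

theorem nbrCount_union {B B' : Finset V} (h : Disjoint B B') (x : V) :
    nbrCount G (B ∪ B') x = nbrCount G B x + nbrCount G B' x := by
  rw [nbrCount, filter_union, card_union_of_disjoint (disjoint_filter_filter h)]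
  rfl

theorem nbrCount_sdiff {X T : Finset V} (h : X ⊆ T) (x : V) :
    nbrCount G T x = nbrCount G (T \ X) x + nbrCount G X x := by
  rw [← nbrCount_union G sdiff_disjoint, sdiff_union_of_subset h]

theorem nbrCount_le_card_sub_one {T : Finset V} {x : V} (hx : x ∈ T) :
    nbrCount G T x ≤ #T - 1 := by
  rw [← card_erase_of_mem hx]
  refine card_le_card fun y hy => ?_
  rw [mem_filter] at hy
  exact mem_erase.2 ⟨hy.2.ne', hy.1⟩

theorem degSum_eq_of_subset {X T : Finset V} (h : X ⊆ T) :
    degSum G T = degSum G (T \ X) + (∑ x ∈ X, nbrCount G T x + ∑ x ∈ X, nbrCount G (T \ X) x) := by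
  rw [degSum, ← sum_sdiff h, sum_congr rfl fun x _ => nbrCount_sdiff G h x, sum_add_distrib,
    sum_nbrCount_comm G (T \ X) X, degSum]
  ring

theorem degSum_erase {T : Finset V} {w : V} (h : w ∈ T) :
    degSum G T = degSum G (T.erase w) + 2 * nbrCount G T w := by
  have h1 := degSum_eq_of_subset G (singleton_subset_iff.2 h)
  have h2 := nbrCount_sdiff G (singleton_subset_iff.2 h) w
  have h3 : nbrCount G {w} w = 0 := by simp [nbrCount, filter_singleton]
  rw [sum_singleton, sum_singleton, sdiff_singleton_eq_erase] at h1
  rw [sdiff_singleton_eq_erase] at h2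
  omega

theorem degSum_le_card_mul (T : Finset V) : degSum G T ≤ #T * (#T - 1) :=
  sum_le_card_nsmul _ _ _ fun _ hx => nbrCount_le_card_sub_one G hx

theorem degSum_le_of_deletable (κ : ℕ) (S : Finset V)
    (h : ∀ T, S ⊂ T → ∃ X ⊆ T \ S, X.Nonempty ∧
      ∑ x ∈ X, nbrCount G T x + ∑ x ∈ X, nbrCount G (T \ X) x ≤ κ * #X)
    (T : Finset V) (hT : S ⊆ T) : degSum G T + κ * #S ≤ degSum G S + κ * #T := by
  induction T using Finset.strongInduction with
  | H T ih =>
    obtain rfl | hne := eq_or_ne S T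
    · rfl
    · obtain ⟨X, hX, hXne, hle⟩ := h T (hT.ssubset_of_ne hne)
      have hXT : X ⊆ T := hX.trans sdiff_subset
      have h1 := ih (T \ X) (sdiff_ssubset hXT hXne)
        (fun y hy => mem_sdiff.2 ⟨hT hy, fun hyX => (mem_sdiff.1 (hX hyX)).2 hy⟩)
      have h2 := degSum_eq_of_subset G hXT
      have h3 := card_sdiff_add_card_eq_card hXT
      rw [← h3, mul_add]
      omega

theorem degSum_le_of_exists_nbrCount_le (d : ℕ) (S : Finset V)
    (h : ∀ T, S ⊂ T → ∃ w ∈ T \ S, nbrCount G T w ≤ d) (T : Finset V) (hT : S ⊆ T) :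
    degSum G T + 2 * d * #S ≤ degSum G S + 2 * d * #T := by
  refine degSum_le_of_deletable G (2 * d) S (fun T hST => ?_) T hT
  obtain ⟨w, hw, hd⟩ := h T hST
  refine ⟨{w}, singleton_subset_iff.2 hw, singleton_nonempty w, ?_⟩
  have := nbrCount_mono G (sdiff_subset : T \ {w} ⊆ T) w
  simp only [sum_singleton, card_singleton]
  omega

theorem degSum_lt_of_exists_nbrCount_le (d : ℕ) (S : Finset V)
    (h : ∀ T, S ⊂ T → ∃ w ∈ T \ S, nbrCount G T w ≤ d) (hS : ∀ w ∉ S, nbrCount G S w < d)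
    (T : Finset V) (hT : S ⊂ T) :
    degSum G T + 2 * d * #S + 2 ≤ degSum G S + 2 * d * #T := by
  induction T using Finset.strongInduction with
  | H T ih =>
    obtain ⟨w, hw, hd⟩ := h T hT
    obtain ⟨hwT, hwS⟩ := mem_sdiff.1 hw
    have h1 := degSum_erase G hwT
    have h2 := card_erase_add_one hwT
    have hsub : S ⊆ T.erase w := fun y hy =>
      mem_erase.2 ⟨fun hyw => hwS (hyw ▸ hy), hT.subset hy⟩
    rw [← h2, mul_add]
    obtain heq | hne := eq_or_ne S (T.erase w)
    · have h3 : nbrCount G T w < d := by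
        refine lt_of_le_of_lt (card_le_card fun y hy => ?_) (hS w hwS)
        rw [mem_filter] at hy ⊢
        exact ⟨heq ▸ mem_erase.2 ⟨hy.2.ne', hy.1⟩, hy.2⟩
      rw [← heq] at h1 ⊢
      omega
    · have := ih _ (erase_ssubset hwT) (hsub.ssubset_of_ne hne)
      omega

variable {G}

theorem nbrCount_add_one_le_length {D : Finset V} {x : V} {p : List V} (hx : x ∈ p)
    (h : ∀ z ∈ D, G.Adj x z → z ∈ p) : nbrCount G D x + 1 ≤ p.length := by
  have h1 : nbrCount G D x ≤ nbrCount G p.toFinset x := by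
    refine card_le_card fun z hz => ?_
    rw [mem_filter] at hz ⊢
    exact ⟨List.mem_toFinset.2 (h z hz.1 hz.2), hz.2⟩
  have h2 := nbrCount_le_card_sub_one G (List.mem_toFinset.2 hx)
  have h3 := List.toFinset_card_le p
  have h4 : 0 < #p.toFinset := card_pos.2 ⟨x, List.mem_toFinset.2 hx⟩
  omega

end Counting

section Paths

variable {V : Type*} (G : SimpleGraph V)

/-- The list `l` is the vertex sequence of a path in `G`. -/
def IsPathList (l : List V) : Prop := l.IsChain G.Adj ∧ l.Nodup

/-- The list `l` is the vertex sequence of a cycle in `G`. -/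
def IsCycleList (l : List V) : Prop :=
  IsPathList G l ∧ 3 ≤ l.length ∧ ∀ x ∈ l.getLast?, ∀ y ∈ l.head?, G.Adj x y

variable {G}

theorem IsPathList.reverse {l : List V} (h : IsPathList G l) : IsPathList G l.reverse :=
  ⟨List.isChain_reverse.2 (h.1.imp fun _ _ => Adj.symm), List.nodup_reverse.2 h.2⟩

theorem IsPathList.of_isInfix {l l' : List V} (h : IsPathList G l) (hl : l' <:+: l) :
    IsPathList G l' := by
  refine ⟨?_, h.2.sublist hl.sublist⟩
  obtain ⟨s, t, rfl⟩ := hl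
  exact (List.isChain_append.1 (List.isChain_append.1 h.1).1).2.1

theorem isPathList_append {l l' : List V} : IsPathList G (l ++ l') ↔
    IsPathList G l ∧ IsPathList G l' ∧ l.Disjoint l' ∧
      ∀ x ∈ l.getLast?, ∀ y ∈ l'.head?, G.Adj x y := by
  simp only [IsPathList, List.isChain_append, List.nodup_append']
  tauto

theorem isPathList_cons {x : V} {l : List V} : IsPathList G (x :: l) ↔
    IsPathList G l ∧ x ∉ l ∧ ∀ y ∈ l.head?, G.Adj x y := by
  simp only [IsPathList, List.isChain_cons, List.nodup_cons]
  tauto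

theorem exists_maximal_nat {α : Type*} {P : α → Prop} {f : α → ℕ} {N : ℕ} (hP : ∃ l, P l)
    (hN : ∀ l, P l → f l ≤ N) : ∃ l, P l ∧ ∀ l', P l' → f l' ≤ f l := by
  classical
  have hex : ∃ k, ∃ l, P l ∧ f l + k = N := by
    obtain ⟨l, hl⟩ := hP
    exact ⟨N - f l, l, hl, Nat.add_sub_cancel' (hN l hl)⟩
  obtain ⟨l, hl, hk⟩ := Nat.find_spec hex
  refine ⟨l, hl, fun l' hl' => ?_⟩
  have := Nat.find_min' hex ⟨l', hl', Nat.add_sub_cancel' (hN l' hl')⟩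
  have := hN l' hl'
  omega

theorem exists_longest {P : List V → Prop} {N : ℕ} (hP : ∃ l, P l)
    (hN : ∀ l, P l → l.length ≤ N) : ∃ l, P l ∧ ∀ l', P l' → l'.length ≤ l.length :=
  exists_maximal_nat hP hN

end Paths

section TwoPaths

variable {V : Type*} {G : SimpleGraph V}

theorem contains_twoP7 {l₁ l₂ : List V} (h₁ : IsPathList G l₁) (h₂ : IsPathList G l₂)
    (hd : l₁.Disjoint l₂) (hl₁ : l₁.length = 7) (hl₂ : l₂.length = 7) : Contains TwoP7 G := by
  have key : ∀ {l : List V}, IsPathList G l → ∀ (hl : l.length = 7) (i j : Fin 7),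
      (pathGraph 7).Adj i j → G.Adj (l.get (i.cast hl.symm)) (l.get (j.cast hl.symm)) := by
    intro l h hl i j hij
    have hc := List.isChain_iff_getElem.1 h.1
    rw [pathGraph_adj] at hij
    rcases hij with hij | hij
    · have := hc i.val (by omega)
      simpa only [List.get_eq_getElem, Fin.val_cast, ← hij] using this
    · have := hc j.val (by omega)
      simpa only [List.get_eq_getElem, Fin.val_cast, ← hij] using this.symm
  refine ⟨⟨Sum.elim (fun i => l₁.get (i.cast hl₁.symm))
    (fun i => l₂.get (i.cast hl₂.symm)), ?_⟩, ?_⟩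
  · rintro (i | i) (j | j) hij
    · exact key h₁ hl₁ i j (by simpa [TwoP7] using hij)
    · simp [TwoP7] at hij
    · simp [TwoP7] at hij
    · exact key h₂ hl₂ i j (by simpa [TwoP7] using hij)
  · refine Function.Injective.sumElim ?_ ?_ ?_
    · exact fun i j hij => by simpa using List.nodup_iff_injective_get.1 h₁.2 hij
    · exact fun i j hij => by simpa using List.nodup_iff_injective_get.1 h₂.2 hij
    · exact fun i j hij => hd (List.get_mem _ _) (by
        have : l₁.get (i.cast hl₁.symm) ∈ l₂ := hij ▸ List.get_mem _ _
        exact this)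

theorem IsPathList.length_le_thirteen (hfree : ¬ Contains TwoP7 G) {l : List V}
    (h : IsPathList G l) : l.length ≤ 13 := by
  by_contra! hl
  refine hfree (contains_twoP7 (l₁ := l.take 7) (l₂ := (l.drop 7).take 7)
    (h.of_isInfix (List.take_prefix 7 l).isInfix)
    (h.of_isInfix ((List.take_prefix 7 _).isInfix.trans (List.drop_suffix 7 l).isInfix)) ?_ ?_ ?_)
  · intro x hx hx'
    exact List.disjoint_take_drop h.2 le_rfl hx ((List.take_subset 7 _) hx')
  · simp; omega
  · simp; omega

end TwoPaths

section ErdosGallai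

variable {V : Type*} {G : SimpleGraph V}

/-- `l` is a path with all vertices in `T`, of maximum length among such paths. -/
def IsLongestPathIn (G : SimpleGraph V) (T : Finset V) (l : List V) : Prop :=
  (IsPathList G l ∧ ∀ x ∈ l, x ∈ T) ∧
    ∀ l', (IsPathList G l' ∧ ∀ x ∈ l', x ∈ T) → l'.length ≤ l.length

theorem IsLongestPathIn.exists_getElem {k : ℕ} (hk : 2 ≤ k)
    (hcyc : ∀ l, IsCycleList G l → l.length ≤ k) {T : Finset V} {a : V} {l : List V}
    (h : IsLongestPathIn G T (a :: l)) {y : V} (hyT : y ∈ T) (hy : G.Adj a y) :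
    ∃ i, ∃ hi : i < l.length, i + 1 < k ∧ l[i] = y := by
  have hyl : y ∈ a :: l := by
    by_contra hyl
    have := h.2 (y :: a :: l) ⟨isPathList_cons.2 ⟨h.1.1, hyl, by simpa using hy.symm⟩, by
      intro x hx
      rcases List.mem_cons.1 hx with rfl | hx
      · exact hyT
      · exact h.1.2 x hx⟩
    simp at this
  have hyl' : y ∈ l := by simpa [hy.ne'] using hyl
  obtain ⟨i, hi, rfl⟩ := List.getElem_of_mem hyl'
  refine ⟨i, hi, ?_, rfl⟩
  by_contra! hik
  have hcl := hcyc ((a :: l).take (i + 2)) ⟨h.1.1.of_isInfix (List.take_prefix _ _).isInfix, ?_, ?_⟩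
  · simp at hcl
    omega
  · simp
    omega
  · intro x hx z hz
    rw [List.take_succ_cons, List.head?_cons, Option.mem_some] at hz
    rw [List.getLast?_take] at hx
    simp [hi] at hx
    subst hx hz
    exact hy.symm

variable [DecidableEq V] [DecidableRel G.Adj]

theorem degSum_le_of_cycle_length_le {N k : ℕ} (hk : 2 ≤ k)
    (hN : ∀ l, IsPathList G l → l.length ≤ N)
    (hcyc : ∀ l, IsCycleList G l → l.length ≤ k) (T : Finset V) (hT : T.Nonempty) :
    degSum G T + k ≤ k * #T := by
  induction T using Finset.strongInduction with
  | H T ih =>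
  obtain ⟨v, hv⟩ := hT
  obtain ⟨l₀, hl₀, hmax₀⟩ := exists_longest (P := fun l => IsPathList G l ∧ ∀ x ∈ l, x ∈ T)
    ⟨[v], ⟨by simp, by simp⟩, by simpa using hv⟩ fun l hl => hN l hl.1
  obtain ⟨⟨a, l⟩, hal, hmax⟩ := exists_maximal_nat (α := V × List V)
    (P := fun p => IsLongestPathIn G T (p.1 :: p.2))
    (f := fun p => nbrCount G T p.1) (N := #T) (by
      cases l₀ with
      | nil => simpa using hmax₀ [v] ⟨⟨by simp, by simp⟩, by simpa using hv⟩
      | cons a l => exact ⟨(a, l), hl₀, hmax₀⟩) fun p _ => card_filter_le _ _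
  dsimp only at hal hmax
  have haT : a ∈ T := hal.1.2 a List.mem_cons_self
  -- the indices of the predecessors on the path of the neighbours of the end vertex
  set I := (range l.length).filter (fun i => G.Adj a (l.getD i a)) with hI
  set g : ℕ → V := fun i => (a :: l).getD i a with hg
  set X := I.image g with hX
  set W := ((a :: l).take k).toFinset with hW
  have hcardW : #W ≤ k := (List.toFinset_card_le _).trans (by simp)
  have hIlt : ∀ i ∈ I, i < l.length := fun i hi => mem_range.1 (mem_filter.1 hi).1
  have hgI : ∀ i, ∀ hi : i ∈ I, g i = (a :: l)[i]'(by
      have := hIlt i hi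
      simp
      omega) := by
    intro i hi
    have := hIlt i hi
    rw [hg]
    exact List.getD_eq_getElem _ _ _
  have hXT : X ⊆ T := by
    intro x hx
    obtain ⟨i, hi, rfl⟩ := mem_image.1 hx
    rw [hgI i hi]
    exact hal.1.2 _ (List.getElem_mem _)
  have hIk : ∀ i ∈ I, i + 1 < k := by
    intro i hi
    have hil := hIlt i hi
    have hadj := (mem_filter.1 hi).2
    rw [List.getD_eq_getElem _ _ hil] at hadj
    obtain ⟨j, hj, hjk, hji⟩ := hal.exists_getElem hk hcyc
      (hal.1.2 _ (List.mem_cons_of_mem _ (List.getElem_mem hil))) hadj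
    have : j = i := (List.Nodup.getElem_inj_iff (List.nodup_cons.1 hal.1.1.2).2).1 hji
    omega
  have hcardI : nbrCount G T a = #I := by
    rw [nbrCount]
    symm
    refine card_bij (fun i _ => l.getD i a) ?_ ?_ ?_
    · intro i hi
      have hil := hIlt i hi
      refine mem_filter.2 ⟨?_, (mem_filter.1 hi).2⟩
      rw [List.getD_eq_getElem _ _ hil]
      exact hal.1.2 _ (List.mem_cons_of_mem _ (List.getElem_mem hil))
    · intro i hi j hj hij
      rw [List.getD_eq_getElem _ _ (hIlt i hi), List.getD_eq_getElem _ _ (hIlt j hj)] at hij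
      exact (List.Nodup.getElem_inj_iff (List.nodup_cons.1 hal.1.1.2).2).1 hij
    · intro y hy
      obtain ⟨hyT, hy⟩ := mem_filter.1 hy
      obtain ⟨i, hi, -, rfl⟩ := hal.exists_getElem hk hcyc hyT hy
      have : l.getD i a = l[i] := List.getD_eq_getElem _ _ hi
      exact ⟨i, mem_filter.2 ⟨mem_range.2 hi, this ▸ hy⟩, this⟩
  have hcardX : #X = #I := by
    refine card_image_of_injOn fun i hi j hj hij => ?_
    rw [hgI i hi, hgI j hj] at hij
    exact (List.Nodup.getElem_inj_iff hal.1.1.2).1 hij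
  have hXW : X ⊆ W := by
    intro x hx
    obtain ⟨i, hi, rfl⟩ := mem_image.1 hx
    rw [hgI i hi, hW, List.mem_toFinset]
    have h1 := hIk i hi
    have h2 := hIlt i hi
    rw [List.mem_take_iff_getElem]
    exact ⟨i, by simp; omega, rfl⟩
  have hrot : ∀ x ∈ X, (∀ y ∈ T, G.Adj x y → y ∈ W) ∧ nbrCount G T x ≤ #I := by
    intro x hx
    obtain ⟨i, hi, rfl⟩ := mem_image.1 hx
    have hil := hIlt i hi
    have hik := hIk i hi
    have hperm : (((a :: l).take (i + 1)).reverse ++ (a :: l).drop (i + 1)).Perm (a :: l) :=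
      (List.Perm.append_right _ (List.reverse_perm _)).trans (by rw [List.take_append_drop])
    have hcons : ((a :: l).take (i + 1)).reverse ++ (a :: l).drop (i + 1) =
        g i :: (((a :: l).take i).reverse ++ (a :: l).drop (i + 1)) := by
      rw [List.take_succ_eq_append_getElem (by simp; omega), List.reverse_append, hgI i hi]
      simp
    have hlong : IsLongestPathIn G T
        (g i :: (((a :: l).take i).reverse ++ (a :: l).drop (i + 1))) := by
      rw [← hcons]
      refine ⟨⟨isPathList_append.2 ⟨(hal.1.1.of_isInfix (List.take_prefix _ _).isInfix).reverse,
        hal.1.1.of_isInfix (List.drop_suffix _ _).isInfix, ?_, ?_⟩, ?_⟩, ?_⟩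
      · intro y hy hy'
        exact List.disjoint_take_drop hal.1.1.2 le_rfl (List.mem_reverse.1 hy) hy'
      · intro y hy z hz
        have hadj := (mem_filter.1 hi).2
        rw [List.getD_eq_getElem _ _ hil] at hadj
        rw [List.getLast?_reverse] at hy
        simp [List.head?_drop, hil] at hy hz
        subst hy hz
        exact hadj
      · exact fun y hy => hal.1.2 y (hperm.mem_iff.1 hy)
      · exact fun l' hl' => (hal.2 l' hl').trans_eq hperm.length_eq.symm
    refine ⟨fun y hyT hy => ?_, hcardI ▸ hmax (g i, _) hlong⟩
    obtain ⟨j, hj, hjk, hjy⟩ := hlong.exists_getElem hk hcyc hyT hy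
    have hmem : y ∈ (g i :: (((a :: l).take i).reverse ++ (a :: l).drop (i + 1))).take k :=
      List.mem_take_iff_getElem.2 ⟨j + 1, by simp at hj ⊢; omega, by simpa using hjy⟩
    rw [← hcons, List.take_append] at hmem
    rw [hW, List.mem_toFinset]
    rcases List.mem_append.1 hmem with hmem | hmem
    · exact (List.take_subset_take_left _ (by omega))
        (List.mem_reverse.1 (List.take_subset _ _ hmem))
    · have hlen : ((a :: l).take (i + 1)).reverse.length = i + 1 := by simp; omega
      rw [hlen, ← List.drop_take] at hmem
      exact List.drop_subset _ _ hmem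
  obtain hI0 | hI0 := I.eq_empty_or_nonempty
  · have h0 : nbrCount G T a = 0 := by rw [hcardI, hI0, card_empty]
    have h1 := degSum_erase G haT
    have h2 := card_erase_add_one haT
    obtain hE | hE := (T.erase a).eq_empty_or_nonempty
    · rw [hE] at h1 h2
      have h3 : degSum G (∅ : Finset V) = 0 := sum_empty
      rw [card_empty] at h2
      rw [h1, h3, h0, ← h2]
      omega
    · have := ih _ (erase_ssubset haT) hE
      rw [← h2, mul_add]
      omega
  · have hlast : (a :: l).getLast (by simp) ∈ T \ X := by
      refine mem_sdiff.2 ⟨hal.1.2 _ (List.getLast_mem _), fun hmem => ?_⟩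
      obtain ⟨i, hi, hgi⟩ := mem_image.1 hmem
      rw [hgI i hi, List.getLast_eq_getElem, List.Nodup.getElem_inj_iff hal.1.1.2] at hgi
      have := hIlt i hi
      simp at hgi
      omega
    have h1 := ih (T \ X) (sdiff_ssubset hXT (hI0.image g)) ⟨_, hlast⟩
    have h2 := degSum_eq_of_subset G hXT
    have h3 := card_sdiff_add_card_eq_card hXT
    have h4 : ∑ x ∈ X, nbrCount G T x ≤ #I * #I := by
      rw [← hcardX]
      exact sum_le_card_nsmul _ _ _ fun x hx => hcardX ▸ (hrot x hx).2
    have h5 : ∑ x ∈ X, nbrCount G (T \ X) x ≤ #I * (k - #I) := by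
      rw [← hcardX]
      refine sum_le_card_nsmul _ _ _ fun x hx => ?_
      calc nbrCount G (T \ X) x ≤ #(W \ X) := card_le_card fun y hy => by
            rw [mem_filter, mem_sdiff] at hy
            exact mem_sdiff.2 ⟨(hrot x hx).1 y hy.1.1 hy.2, hy.1.2⟩
        _ = #W - #X := card_sdiff_of_subset hXW
        _ ≤ k - #X := Nat.sub_le_sub_right hcardW _
    have h6 : #I ≤ k := hcardX ▸ (card_le_card hXW).trans hcardW
    have h7 : #I * #I + #I * (k - #I) = k * #I := by
      rw [← mul_add, Nat.add_sub_cancel' h6, mul_comm]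
    rw [← h3, mul_add, hcardX]
    omega

end ErdosGallai

section CycleMaps

variable {V : Type*} {G : SimpleGraph V} {c : ℕ}

/-- The map `f` is a cyclic parametrisation of a cycle of length `c`. -/
def IsCycleMap (G : SimpleGraph V) (f : ZMod c → V) : Prop :=
  Function.Injective f ∧ ∀ i, G.Adj (f i) (f (i + 1))

/-- The list of `m` consecutive values of `f`, starting from `f i`. -/
def arc (f : ZMod c → V) (i : ZMod c) (m : ℕ) : List V := (List.range m).map fun k : ℕ => f (i + k)

theorem IsCycleMap.comp_neg {f : ZMod c → V} (hf : IsCycleMap G f) :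
    IsCycleMap G fun i => f (-i) := by
  refine ⟨hf.1.comp neg_injective, fun i => ?_⟩
  have := hf.2 (-(i + 1))
  rw [neg_add, neg_add_cancel_right] at this
  dsimp only
  rw [neg_add]
  exact this.symm

theorem length_arc (f : ZMod c → V) (i : ZMod c) (m : ℕ) : (arc f i m).length = m := by simp [arc]

theorem mem_arc {f : ZMod c → V} {i : ZMod c} {m : ℕ} {x : V} :
    x ∈ arc f i m ↔ ∃ k < m, f (i + (k : ℕ)) = x := by simp [arc]

theorem head?_arc (f : ZMod c → V) (i : ZMod c) {m : ℕ} (hm : 0 < m) :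
    (arc f i m).head? = some (f i) := by
  obtain ⟨m, rfl⟩ := Nat.exists_eq_succ_of_ne_zero hm.ne'
  simp [arc, List.range_succ_eq_map]

theorem getLast?_arc (f : ZMod c → V) (i : ZMod c) {m : ℕ} (hm : 0 < m) :
    (arc f i m).getLast? = some (f (i + (m - 1 : ℕ))) := by
  obtain ⟨m, rfl⟩ := Nat.exists_eq_succ_of_ne_zero hm.ne'
  simp [arc, List.range_succ]

theorem arc_append (f : ZMod c → V) (i : ZMod c) (m m' : ℕ) :
    arc f i m ++ arc f (i + m) m' = arc f i (m + m') := by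
  simp [arc, List.range_add, add_assoc]

theorem natCast_inj_of_lt {k k' : ℕ} (hk : k < c) (hk' : k' < c)
    (h : (k : ZMod c) = k') : k = k' := by
  have := congrArg ZMod.val h
  rwa [ZMod.val_cast_of_lt hk, ZMod.val_cast_of_lt hk'] at this

theorem isPathList_arc {f : ZMod c → V} (hf : IsCycleMap G f) (i : ZMod c) {m : ℕ} (hm : m ≤ c) :
    IsPathList G (arc f i m) := by
  constructor
  · rw [arc, List.isChain_map, List.isChain_range]
    intro k _
    have := hf.2 (i + k)
    rwa [add_assoc, ← Nat.cast_succ] at this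
  · refine List.Nodup.map_on (fun k hk k' hk' h => ?_) List.nodup_range
    rw [List.mem_range] at hk hk'
    exact natCast_inj_of_lt (by omega) (by omega) (add_left_cancel (hf.1 h))

theorem arc_disjoint {f : ZMod c → V} (hf : IsCycleMap G f) (i : ZMod c) {m m' : ℕ}
    (hm : m + m' ≤ c) : (arc f i m).Disjoint (arc f (i + m) m') :=
  (isPathList_append.1 (arc_append f i m m' ▸ isPathList_arc hf i hm)).2.2.1

variable [NeZero c]

theorem IsCycleList.exists_isCycleMap {l : List V} (hl : IsCycleList G l) (hc : l.length = c) :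
    ∃ f : ZMod c → V, IsCycleMap G f := by
  have hcpos := NeZero.pos c
  refine ⟨fun i => l[i.val]'(hc ▸ i.val_lt), fun i j hij => ?_, fun i => ?_⟩
  · exact ZMod.val_injective c ((List.Nodup.getElem_inj_iff hl.1.2).1 hij)
  · have h3 := hl.2.1
    have : Fact (1 < c) := ⟨by omega⟩
    by_cases h : i.val + 1 < c
    · have hv : (i + 1).val = i.val + 1 := by
        rw [ZMod.val_add_of_lt (by rwa [ZMod.val_one]), ZMod.val_one]
      simp only [hv]
      exact List.isChain_iff_getElem.1 hl.1.1 i.val (by omega)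
    · have hi := i.val_lt
      have hv : (i + 1).val = 0 := by
        rw [ZMod.val_add, ZMod.val_one, show i.val + 1 = c by omega, Nat.mod_self]
      simp only [hv]
      refine hl.2.2 _ ?_ _ ?_
      · rw [List.getLast?_eq_getElem?, Option.mem_def, List.getElem?_eq_some_iff]
        exact ⟨by omega, by congr 1; omega⟩
      · rw [List.head?_eq_getElem?, Option.mem_def, List.getElem?_eq_some_iff]
        exact ⟨by omega, rfl⟩

theorem IsCycleMap.isCycleList_append_arc {f : ZMod c → V} (hf : IsCycleMap G f) {p : List V}
    (hp : IsPathList G p) (hne : p ≠ []) (hdisj : ∀ i, f i ∉ p) {i j : ZMod c} (hij : i ≠ j)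
    (hi : ∀ x ∈ p.head?, G.Adj x (f i)) (hj : ∀ x ∈ p.getLast?, G.Adj x (f j)) :
    IsCycleList G (p ++ arc f j (c - (j - i).val + 1)) := by
  have hpos : 0 < (j - i).val := by
    rw [Nat.pos_iff_ne_zero, Ne, ZMod.val_eq_zero, sub_eq_zero]
    exact hij.symm
  have hlt := (j - i).val_lt
  have hlen : 0 < p.length := List.length_pos_iff.2 hne
  refine ⟨isPathList_append.2 ⟨hp, isPathList_arc hf _ (by omega), ?_, ?_⟩, ?_, ?_⟩
  · intro x hx hx'
    obtain ⟨k, -, rfl⟩ := mem_arc.1 hx'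
    exact hdisj _ hx
  · intro x hx y hy
    rw [head?_arc _ _ (by omega), Option.mem_some] at hy
    exact hy ▸ hj x hx
  · rw [List.length_append, length_arc]
    omega
  · intro x hx y hy
    rw [List.getLast?_append, getLast?_arc _ _ (by omega), Option.some_or, Option.mem_some] at hx
    rw [List.head?_append_of_ne_nil _ hne] at hy
    have : j + ((c - (j - i).val + 1 - 1 : ℕ) : ZMod c) = i := by
      rw [Nat.add_sub_cancel, Nat.cast_sub hlt.le]
      simp
    rw [← hx, this]
    exact (hi y hy).symm

theorem IsCycleMap.length_lt_val_sub {f : ZMod c → V} (hf : IsCycleMap G f)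
    (hmax : ∀ l, IsCycleList G l → l.length ≤ c) {p : List V}
    (hp : IsPathList G p) (hne : p ≠ []) (hdisj : ∀ i, f i ∉ p) {i j : ZMod c} (hij : i ≠ j)
    (hi : ∀ x ∈ p.head?, G.Adj x (f i)) (hj : ∀ x ∈ p.getLast?, G.Adj x (f j)) :
    p.length < (j - i).val := by
  have h := hmax _ (hf.isCycleList_append_arc hp hne hdisj hij hi hj)
  have hlt := (j - i).val_lt
  rw [List.length_append, length_arc] at h
  omega

theorem IsCycleMap.not_adj_add_one {f : ZMod c → V} (hf : IsCycleMap G f)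
    (hmax : ∀ l, IsCycleList G l → l.length ≤ c) {u : V} (hu : ∀ i, u ≠ f i) {i j : ZMod c}
    (hij : i ≠ j) (hi : G.Adj u (f i)) (hj : G.Adj u (f j)) : ¬ G.Adj (f (i + 1)) (f (j + 1)) := by
  intro hadj
  have hpos : 0 < (j - i).val := by
    rw [Nat.pos_iff_ne_zero, Ne, ZMod.val_eq_zero, sub_eq_zero]
    exact hij.symm
  have hlt := (j - i).val_lt
  have hji : i + 1 + (((j - i).val : ℕ) : ZMod c) = j + 1 := by
    rw [ZMod.natCast_zmod_val]
    ring
  have hlast : i + 1 + (((j - i).val - 1 : ℕ) : ZMod c) = j := by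
    rw [Nat.cast_sub hpos, ZMod.natCast_zmod_val]
    push_cast
    ring
  have hlast' : j + 1 + ((c - (j - i).val - 1 : ℕ) : ZMod c) = i := by
    rw [Nat.sub_right_comm, Nat.cast_sub (by omega), Nat.cast_sub (by omega), ZMod.natCast_zmod_val,
      ZMod.natCast_self]
    push_cast
    ring
  have hd := arc_disjoint hf (i + 1) (m := (j - i).val) (m' := c - (j - i).val) (by omega)
  rw [hji] at hd
  have hpath : IsPathList G
      ((arc f (i + 1) (j - i).val).reverse ++ arc f (j + 1) (c - (j - i).val)) := by
    refine isPathList_append.2 ⟨(isPathList_arc hf _ hlt.le).reverse,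
      isPathList_arc hf _ (by omega), fun x hx => hd (List.mem_reverse.1 hx), fun x hx y hy => ?_⟩
    rw [List.getLast?_reverse, head?_arc _ _ hpos, Option.mem_some] at hx
    rw [head?_arc _ _ (by omega), Option.mem_some] at hy
    exact hx ▸ hy ▸ hadj
  have hmem : u ∉ (arc f (i + 1) (j - i).val).reverse ++ arc f (j + 1) (c - (j - i).val) := by
    intro h
    rcases List.mem_append.1 h with h | h
    · obtain ⟨k, -, hk⟩ := mem_arc.1 (List.mem_reverse.1 h)
      exact hu _ hk.symm
    · obtain ⟨k, -, hk⟩ := mem_arc.1 h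
      exact hu _ hk.symm
  have hne : (arc f (i + 1) (j - i).val).reverse ≠ [] := by
    rw [← List.length_pos_iff, List.length_reverse, length_arc]
    exact hpos
  have hcycle : IsCycleList G
      (u :: ((arc f (i + 1) (j - i).val).reverse ++ arc f (j + 1) (c - (j - i).val))) := by
    refine ⟨isPathList_cons.2 ⟨hpath, hmem, fun x hx => ?_⟩, ?_, fun x hx y hy => ?_⟩
    · rw [List.head?_append_of_ne_nil _ hne, List.head?_reverse, getLast?_arc _ _ hpos, hlast,
        Option.mem_some] at hx
      exact hx ▸ hj
    · simp only [List.length_cons, List.length_append, List.length_reverse, length_arc]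
      omega
    · rw [← List.cons_append, List.getLast?_append, getLast?_arc _ _ (by omega), hlast',
        Option.some_or, Option.mem_some] at hx
      rw [List.head?_cons, Option.mem_some] at hy
      exact hx ▸ hy ▸ hi.symm
  have := hmax _ hcycle
  simp only [List.length_cons, List.length_append, List.length_reverse, length_arc] at this
  omega

theorem IsCycleMap.not_adj_sub_one {f : ZMod c → V} (hf : IsCycleMap G f)
    (hmax : ∀ l, IsCycleList G l → l.length ≤ c) {u : V} (hu : ∀ i, u ≠ f i) {i j : ZMod c}
    (hij : i ≠ j) (hi : G.Adj u (f i)) (hj : G.Adj u (f j)) : ¬ G.Adj (f (i - 1)) (f (j - 1)) := by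
  have h := hf.comp_neg.not_adj_add_one hmax (fun k => hu (-k)) (i := -i) (j := -j)
    (by simpa using hij) (by simpa using hi) (by simpa using hj)
  rwa [neg_add, neg_neg, neg_add, neg_neg, ← sub_eq_add_neg, ← sub_eq_add_neg] at h

end CycleMaps

section Attachments

variable {V : Type*} {G : SimpleGraph V} {c : ℕ} {f : ZMod c → V}

/-- `p` is a path that avoids the image of `f` and whose last vertex is adjacent to that image. -/
def IsTail (G : SimpleGraph V) (f : ZMod c → V) (p : List V) : Prop :=
  IsPathList G p ∧ (∀ i, f i ∉ p) ∧ ∃ x ∈ p.getLast?, ∃ i, G.Adj x (f i)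

theorem IsTail.ne_nil {p : List V} (h : IsTail G f p) : p ≠ [] := by
  rintro rfl
  obtain ⟨x, hx, -⟩ := h.2.2
  simp at hx

theorem IsTail.cons {y x : V} {p : List V} (h : IsTail G f (x :: p)) (hxy : G.Adj y x)
    (hy : y ∉ x :: p) (hyf : ∀ i, f i ≠ y) : IsTail G f (y :: x :: p) := by
  refine ⟨isPathList_cons.2 ⟨h.1, hy, by simpa using hxy⟩, fun i hi => ?_, ?_⟩
  · rcases List.mem_cons.1 hi with hi | hi
    · exact hyf i hi
    · exact h.2.1 i hi
  · rw [List.getLast?_cons_cons]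
    exact h.2.2

theorem isTail_singleton {y : V} {i : ZMod c} (hy : ∀ i, f i ≠ y) (h : G.Adj y (f i)) :
    IsTail G f [y] :=
  ⟨⟨by simp, by simp⟩, by simpa using hy, y, by simp, i, h⟩

theorem IsTail.exists_of_mem {y : V} {p : List V} (h : IsTail G f p) (hy : y ∈ p) :
    ∃ p', IsTail G f (y :: p') := by
  obtain ⟨s, t, rfl⟩ := List.append_of_mem hy
  refine ⟨t, h.1.of_isInfix (List.suffix_append _ _).isInfix,
    fun i hi => h.2.1 i (List.mem_append_right _ hi), ?_⟩
  have := h.2.2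
  rwa [List.getLast?_append_of_ne_nil _ (by simp)] at this

theorem exists_isTail (hconn : G.Connected) {y : V} (hy : ∀ i, f i ≠ y) :
    ∃ p, IsTail G f (y :: p) := by
  obtain ⟨w⟩ := hconn.preconnected (f 0) y
  suffices h : ∀ {a b : V}, G.Walk a b → ((∃ i, f i = a) ∨ ∃ p, IsTail G f (a :: p)) →
      ((∃ i, f i = b) ∨ ∃ p, IsTail G f (b :: p)) by
    rcases h w (.inl ⟨0, rfl⟩) with ⟨i, hi⟩ | h
    · exact absurd hi (hy i)
    · exact h
  intro a b w
  induction w with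
  | nil => exact id
  | @cons u v w huv _ ih =>
    intro hu
    refine ih ?_
    by_cases hv : ∃ i, f i = v
    · exact .inl hv
    · have hv' : ∀ i, f i ≠ v := fun i hi => hv ⟨i, hi⟩
      refine .inr ?_
      rcases hu with ⟨i, rfl⟩ | ⟨p, hp⟩
      · exact ⟨[], isTail_singleton hv' huv.symm⟩
      · by_cases hvp : v ∈ u :: p
        · exact hp.exists_of_mem hvp
        · exact ⟨u :: p, hp.cons huv.symm hvp hv'⟩

variable [NeZero c]

theorem IsTail.length_add_le {N : ℕ} (hN : ∀ l, IsPathList G l → l.length ≤ N)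
    (hf : IsCycleMap G f) {p : List V} (hp : IsTail G f p) : p.length + c ≤ N := by
  obtain ⟨x, hx, i, hi⟩ := hp.2.2
  have h := hN (p ++ arc f i c) (isPathList_append.2 ⟨hp.1, isPathList_arc hf i le_rfl, ?_, ?_⟩)
  · rwa [List.length_append, length_arc] at h
  · intro y hy hy'
    obtain ⟨k, -, rfl⟩ := mem_arc.1 hy'
    exact hp.2.1 _ hy
  · intro y hy z hz
    rw [head?_arc _ _ (NeZero.pos c), Option.mem_some] at hz
    obtain rfl := Option.mem_unique hx hy
    exact hz ▸ hi

theorem card_image_cycle [DecidableEq V] (hf : IsCycleMap G f) : #(univ.image f) = c := by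
  rw [card_image_of_injective _ hf.1, card_univ, ZMod.card]

variable [DecidableRel G.Adj]

/-- The positions of the neighbours of `u` on the cycle parametrised by `f`. -/
def foot (G : SimpleGraph V) [DecidableRel G.Adj] (f : ZMod c → V) (u : V) : Finset (ZMod c) :=
  univ.filter fun i => G.Adj u (f i)

theorem mem_foot {u : V} {i : ZMod c} : i ∈ foot G f u ↔ G.Adj u (f i) := by simp [foot]

theorem foot_add_one_notMem (hc : 2 ≤ c) (hf : IsCycleMap G f)
    (hmax : ∀ l, IsCycleList G l → l.length ≤ c) {u : V} (hu : ∀ i, f i ≠ u) :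
    ∀ i ∈ foot G f u, i + 1 ∉ foot G f u := by
  intro i hi hi'
  rw [mem_foot] at hi hi'
  have : Fact (1 < c) := ⟨hc⟩
  have h := hf.length_lt_val_sub hmax (p := [u]) ⟨by simp, by simp⟩ (by simp) (by simpa using hu)
    (i := i) (j := i + 1) (by simp) (by simpa using hi) (by simpa using hi')
  rw [add_sub_cancel_left, ZMod.val_one] at h
  simp at h

theorem not_adj_of_mem_shiftPairs (hf : IsCycleMap G f)
    (hmax : ∀ l, IsCycleList G l → l.length ≤ c) {u : V} (hu : ∀ i, f i ≠ u)
    {x : ZMod c × ZMod c} (hx : x ∈ shiftPairs (foot G f u)) :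
    x.1 ≠ x.2 ∧ ¬ G.Adj (f x.1) (f x.2) := by
  rw [shiftPairs, mem_union, mem_image, mem_image] at hx
  rcases hx with ⟨y, hy, rfl⟩ | ⟨y, hy, rfl⟩ <;>
    simp only [mem_offDiag, mem_foot] at hy
  · exact ⟨by simpa using hy.2.2,
      hf.not_adj_add_one hmax (fun i => (hu i).symm) hy.2.2 hy.1 hy.2.1⟩
  · exact ⟨by simpa using hy.2.2,
      hf.not_adj_sub_one hmax (fun i => (hu i).symm) hy.2.2 hy.1 hy.2.1⟩

theorem foot_subset_farFrom (hf : IsCycleMap G f) (hmax : ∀ l, IsCycleList G l → l.length ≤ c)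
    {p : List V} (hp : IsPathList G p) (hdisj : ∀ i, f i ∉ p) {a b : V} (ha : a ∈ p.head?)
    (hb : b ∈ p.getLast?) : foot G f b ⊆ farFrom p.length (foot G f a) := by
  intro j hj
  rw [mem_foot] at hj
  rw [farFrom, mem_filter]
  refine ⟨mem_univ _, fun i hi => ?_⟩
  rw [mem_foot] at hi
  have hne : p ≠ [] := by
    rintro rfl
    simp at ha
  by_cases hij : j = i
  · exact .inl hij
  · refine .inr ⟨hf.length_lt_val_sub hmax hp hne hdisj (Ne.symm hij) ?_ ?_, ?_⟩
    · exact fun x hx => Option.mem_unique ha hx ▸ hi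
    · exact fun x hx => Option.mem_unique hb hx ▸ hj
    · rw [← List.length_reverse]
      refine hf.length_lt_val_sub hmax hp.reverse (by simpa using hne) (by simpa using hdisj)
        hij ?_ ?_
      · rw [List.head?_reverse]
        exact fun x hx => Option.mem_unique hb hx ▸ hj
      · rw [List.getLast?_reverse]
        exact fun x hx => Option.mem_unique ha hx ▸ hi

variable [DecidableEq V]

theorem nbrCount_image (hf : IsCycleMap G f) (u : V) :
    nbrCount G (univ.image f) u = #(foot G f u) := by
  rw [nbrCount, filter_image, card_image_of_injective _ hf.1, foot]

theorem degSum_image_add_le (hf : IsCycleMap G f) (M : Finset (ZMod c × ZMod c))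
    (hM : ∀ x ∈ M, x.1 ≠ x.2 ∧ ¬ G.Adj (f x.1) (f x.2)) :
    degSum G (univ.image f) + #M ≤ c * (c - 1) := by
  have h1 : degSum G (univ.image f) =
      #((univ : Finset (ZMod c × ZMod c)).filter fun x => G.Adj (f x.1) (f x.2)) := by
    rw [degSum, sum_image hf.1.injOn, sum_congr rfl fun i _ => nbrCount_image hf (f i)]
    simp only [foot, card_filter]
    rw [← univ_product_univ, sum_product]
  have h2 : #((univ : Finset (ZMod c)).offDiag) = c * (c - 1) := by
    rw [offDiag_card, card_univ, ZMod.card, Nat.mul_sub_one]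
  rw [h1, ← h2, ← card_union_of_disjoint]
  · refine card_le_card fun x hx => ?_
    rcases mem_union.1 hx with hx | hx
    · simp only [mem_offDiag, mem_univ, true_and]
      intro h
      have := (mem_filter.1 hx).2
      rw [h] at this
      exact G.irrefl this
    · simpa using (hM x hx).1
  · rw [Finset.disjoint_left]
    intro x hx hx'
    exact (hM x hx').2 (mem_filter.1 hx).2

theorem nbrCount_image_union (hf : IsCycleMap G f) {D : Finset V} (hD : ∀ z ∈ D, ∀ i, f i ≠ z)
    (u : V) : nbrCount G (univ.image f ∪ D) u = #(foot G f u) + nbrCount G D u := by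
  rw [nbrCount_union, nbrCount_image hf]
  rw [Finset.disjoint_right]
  intro z hz hz'
  obtain ⟨i, -, hi⟩ := mem_image.1 hz'
  exact hD z hz i hi

/-- If every vertex of a set `D` outside a longest cycle is attached to the cycle or has large
degree, then either `D` is independent and all its vertices are attached, or `D` contains
two vertices whose neighbourhoods on the cycle are far apart. -/
theorem attached_or_exists_farFrom {N : ℕ} (hN : ∀ l, IsPathList G l → l.length ≤ N)
    (hconn : G.Connected) (hf : IsCycleMap G f) (hmax : ∀ l, IsCycleList G l → l.length ≤ c)
    {D : Finset V} (hD : ∀ z ∈ D, ∀ i, f i ≠ z)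
    (hdeg : ∀ z ∈ D, (foot G f z).Nonempty ∨ N + 2 ≤ c + nbrCount G (univ.image f ∪ D) z) :
    (∀ z ∈ D, (foot G f z).Nonempty ∧ ∀ z' ∈ D, ¬ G.Adj z z') ∨
      ∃ a ∈ D, ∃ b ∈ D, ∃ q, a ≠ b ∧ (q = 2 → G.Adj a b) ∧ 2 ≤ q ∧ q + c ≤ N ∧
        nbrCount G D a + 1 ≤ q ∧
        nbrCount G D b + 1 ≤ q ∧ foot G f b ⊆ farFrom q (foot G f a) := by
  have hlen : ∀ p, IsTail G f p → p.length + c ≤ N := fun p hp => hp.length_add_le hN hf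
  -- a vertex of `D` with no neighbour on the cycle has many neighbours in `D`
  have hun : ∀ z ∈ D, ¬ (foot G f z).Nonempty → N + 2 ≤ c + nbrCount G D z := by
    intro z hz hfz
    have h := (hdeg z hz).resolve_left hfz
    rw [nbrCount_image_union hf hD, not_nonempty_iff_eq_empty.1 hfz, card_empty] at h
    omega
  by_cases hex : ∃ x ∈ D, ∃ y ∈ D, G.Adj x y ∧ (foot G f y).Nonempty
  · obtain ⟨x, hxD, y, hyD, hxy, i, hi⟩ := hex
    rw [mem_foot] at hi
    obtain ⟨p, ⟨hp, hpD⟩, hpmax⟩ := exists_longest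
      (P := fun p => IsTail G f p ∧ ∀ z ∈ p, z ∈ D)
      ⟨[x, y], (isTail_singleton (hD y hyD) hi).cons hxy (by simpa using hxy.ne) (hD x hxD), by
        simp [hxD, hyD]⟩ (N := N) fun l hl => by have := hlen l hl.1; omega
    have h2 : 2 ≤ p.length := hpmax [x, y]
      ⟨(isTail_singleton (hD y hyD) hi).cons hxy (by simpa using hxy.ne) (hD x hxD), by
        simp [hxD, hyD]⟩
    -- the first vertex of a longest tail inside `D` has no further neighbour in `D`
    have hhead : ∀ p', (IsTail G f p' ∧ ∀ z ∈ p', z ∈ D) → p'.length = p.length →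
        ∀ a ∈ p'.head?, ∀ z ∈ D, G.Adj a z → z ∈ p' := by
      intro p' hp' hlen' a ha z hz haz
      cases p' with
      | nil => simp at ha
      | cons a' p' =>
        obtain rfl : a' = a := by simpa using ha
        by_contra hzp
        have := hpmax (z :: a' :: p') ⟨hp'.1.cons haz.symm hzp (hD z hz), fun w hw => by
          rcases List.mem_cons.1 hw with rfl | hw
          · exact hz
          · exact hp'.2 w hw⟩
        simp at this hlen'
        omega
    have hq := hlen p hp
    obtain ⟨b, hb, j, hj⟩ := hp.2.2
    obtain ⟨a, ha⟩ : ∃ a, a ∈ p.head? :=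
      ⟨p.head hp.ne_nil, by rw [Option.mem_def, List.head?_eq_some_head]⟩
    have hap : a ∈ p := List.mem_of_mem_head? ha
    have hbp : b ∈ p := List.mem_of_mem_getLast? hb
    have hna : nbrCount G D a + 1 ≤ p.length :=
      nbrCount_add_one_le_length hap (hhead p ⟨hp, hpD⟩ rfl a ha)
    have hfa : (foot G f a).Nonempty := by
      by_contra hfa
      have := hun a (hpD a hap) hfa
      omega
    obtain ⟨i', hi'⟩ := hfa
    rw [mem_foot] at hi'
    have hnb : nbrCount G D b + 1 ≤ p.length := by
      refine nbrCount_add_one_le_length hbp fun z hz hbz => List.mem_reverse.1 ?_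
      refine hhead p.reverse ⟨⟨hp.1.reverse, by simpa using hp.2.1, a, ?_, i', hi'⟩,
        by simpa using hpD⟩ (by simp) b ?_ z hz hbz
      · rwa [List.getLast?_reverse]
      · rwa [List.head?_reverse]
    refine .inr ⟨a, hpD a hap, b, hpD b hbp, p.length, ?_, ?_, h2, hq, hna, hnb,
      foot_subset_farFrom hf hmax hp.1 hp.2.1 ha hb⟩
    · rintro rfl
      cases p with
      | nil => simp at h2
      | cons x l =>
        obtain rfl : x = a := by simpa using ha
        cases l with
        | nil => simp at h2
        | cons y l =>
          rw [List.getLast?_cons_cons] at hb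
          exact (List.nodup_cons.1 hp.1.2).1 (List.mem_of_mem_getLast? hb)
    · intro hlen2
      obtain ⟨x, y, rfl⟩ := List.length_eq_two.1 hlen2
      obtain rfl : x = a := by simpa using ha
      obtain rfl : y = b := by simpa using hb
      simpa using hp.1.1
  · push Not at hex
    left
    have hall : ∀ z ∈ D, (foot G f z).Nonempty := by
      intro z hz
      by_contra hfz
      obtain ⟨⟨y, p⟩, ⟨hp, hyD, hfy⟩, hpmax⟩ := exists_maximal_nat (α := V × List V)
        (P := fun s => IsTail G f (s.1 :: s.2) ∧ s.1 ∈ D ∧ ¬ (foot G f s.1).Nonempty)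
        (f := fun s => s.2.length) (N := N) (by
          obtain ⟨p, hp⟩ := exists_isTail hconn (hD z hz)
          exact ⟨(z, p), hp, hz, hfz⟩) (fun s hs => by
          have := hlen _ hs.1
          simp at this
          omega)
      dsimp only at hp hyD hfy hpmax
      have h1 := hun y hyD hfy
      have h2 := hlen _ hp
      obtain ⟨w, hwD, hyw, hwp⟩ : ∃ w ∈ D, G.Adj y w ∧ w ∉ y :: p := by
        by_contra! h
        have := nbrCount_add_one_le_length (p := y :: p) (by simp) h
        omega
      have := hpmax (w, y :: p) ⟨hp.cons hyw.symm hwp (hD w hwD), hwD,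
        by simp [hex y hyD w hwD hyw]⟩
      simp at this
    exact fun z hz => ⟨hall z hz, fun z' hz' h =>
      absurd (hall z' hz') (by rw [hex z hz z' hz' h]; simp)⟩

end Attachments

section CycleTen

variable {V : Type*} {G : SimpleGraph V}

theorem le_card_shiftPairs {c : ℕ} (A : Finset (ZMod c)) : #A * (#A - 1) ≤ #(shiftPairs A) := by
  rw [Nat.mul_sub_one, ← offDiag_card]
  refine le_trans (ge_of_eq (card_image_of_injOn ?_)) (card_le_card subset_union_left)
  intro x _ y _ h
  simpa [Prod.ext_iff] using h

theorem card_le_five_of_sparse_ten {A : Finset (ZMod 10)} (hA : ∀ i ∈ A, i + 1 ∉ A) : #A ≤ 5 := by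
  by_contra! h
  obtain ⟨t, rfl⟩ := sparse_ten A hA (by omega)
  exact absurd (card_le_five : #{t, t + 2, t + 4, t + 6, t + 8} ≤ 5) (by omega)

theorem card_le_five_of_sparse_eleven {A : Finset (ZMod 11)} (hA : ∀ i ∈ A, i + 1 ∉ A) :
    #A ≤ 5 := by
  by_contra! h
  obtain ⟨t, rfl⟩ := sparse_eleven A hA (by omega)
  exact absurd (card_le_five : #{t, t + 2, t + 4, t + 6, t + 8} ≤ 5) (by omega)

variable [DecidableRel G.Adj] [DecidableEq V]

theorem card_foot_of_independent {c : ℕ} [NeZero c] {f : ZMod c → V} (hf : IsCycleMap G f)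
    {D : Finset V} (hD : ∀ z ∈ D, ∀ i, f i ≠ z) {z : V} (hz : ∀ z' ∈ D, ¬ G.Adj z z') :
    #(foot G f z) = nbrCount G (univ.image f ∪ D) z := by
  rw [nbrCount_image_union hf hD, nbrCount, filter_false_of_mem hz, card_empty, add_zero]

theorem card_foot_eq_of_five_le_ten {f : ZMod 10 → V}
    (hN : ∀ l, IsPathList G l → l.length ≤ 13) (hconn : G.Connected) (hf : IsCycleMap G f)
    (hmax : ∀ l, IsCycleList G l → l.length ≤ 10) {D : Finset V} (hD : ∀ z ∈ D, ∀ i, f i ≠ z)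
    (hdeg : ∀ z ∈ D, 5 ≤ nbrCount G (univ.image f ∪ D) z) :
    ∀ z ∈ D, #(foot G f z) = nbrCount G (univ.image f ∪ D) z := by
  rcases attached_or_exists_farFrom hN hconn hf hmax hD fun z hz => .inr (by
    have := hdeg z hz
    omega) with h | ⟨a, ha, b, hb, q, -, -, h2, hq, hqa, hqb, hab⟩
  · exact fun z hz => card_foot_of_independent hf hD (h z hz).2
  · have ha' := hdeg a ha
    have hb' := hdeg b hb
    rw [nbrCount_image_union hf hD] at ha' hb'
    have hs := foot_add_one_notMem (by norm_num) hf hmax (hD a ha)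
    have hle := card_le_card hab
    obtain rfl | rfl : q = 2 ∨ q = 3 := by omega
    · have := card_farFrom_two_ten _ hs (by omega)
      omega
    · have := card_farFrom_three_ten _ hs (by omega)
      omega

theorem card_foot_eq_of_five_le_eleven {f : ZMod 11 → V}
    (hN : ∀ l, IsPathList G l → l.length ≤ 13) (hconn : G.Connected) (hf : IsCycleMap G f)
    (hmax : ∀ l, IsCycleList G l → l.length ≤ 11) {D : Finset V} (hD : ∀ z ∈ D, ∀ i, f i ≠ z)
    (hdeg : ∀ z ∈ D, 5 ≤ nbrCount G (univ.image f ∪ D) z) :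
    ∀ z ∈ D, #(foot G f z) = nbrCount G (univ.image f ∪ D) z := by
  rcases attached_or_exists_farFrom hN hconn hf hmax hD fun z hz => .inr (by
    have := hdeg z hz
    omega) with h | ⟨a, ha, b, hb, q, -, -, h2, hq, hqa, hqb, hab⟩
  · exact fun z hz => card_foot_of_independent hf hD (h z hz).2
  · have ha' := hdeg a ha
    have hb' := hdeg b hb
    rw [nbrCount_image_union hf hD] at ha' hb'
    have hs := foot_add_one_notMem (by norm_num) hf hmax (hD a ha)
    have hle := card_le_card hab
    obtain rfl : q = 2 := by omega
    have := card_farFrom_two_eleven _ hs (by omega)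
    omega

theorem forall_ne_of_disjoint_image {c : ℕ} [NeZero c] {f : ZMod c → V} {T : Finset V} :
    ∀ z ∈ T \ univ.image f, ∀ i, f i ≠ z := by
  rintro z hz i rfl
  exact (mem_sdiff.1 hz).2 (mem_image_of_mem f (mem_univ i))

theorem degSum_univ_le_of_longest_cycle_ten [Fintype V] {f : ZMod 10 → V}
    (hN : ∀ l, IsPathList G l → l.length ≤ 13) (hconn : G.Connected) (hf : IsCycleMap G f)
    (hmax : ∀ l, IsCycleList G l → l.length ≤ 10) :
    degSum G univ ≤ 8 * Fintype.card V + 10 ∨ degSum G univ + 30 ≤ 10 * Fintype.card V := by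
  have hC := card_image_cycle hf
  by_cases hu : ∃ u, (∀ i, f i ≠ u) ∧ 5 ≤ #(foot G f u)
  · obtain ⟨u, hu, h5⟩ := hu
    right
    have huC : u ∉ univ.image f := by simpa using hu
    have h5' := card_le_five_of_sparse_ten (foot_add_one_notMem (by norm_num) hf hmax hu)
    have hdel := degSum_le_of_exists_nbrCount_le G 5 (insert u (univ.image f)) (fun T hT => ?_)
      univ (subset_univ _)
    · have h1 := degSum_image_add_le hf (shiftPairs (foot G f u)) fun x hx =>
        not_adj_of_mem_shiftPairs hf hmax hu hx
      have h2 := le_card_shiftPairs (foot G f u)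
      have h3 := degSum_erase G (mem_insert_self u (univ.image f))
      have h4 : nbrCount G (insert u (univ.image f)) u = #(foot G f u) := by
        rw [← nbrCount_image hf, nbrCount, nbrCount, filter_insert, if_neg (G.irrefl)]
      rw [erase_insert huC, h4] at h3
      rw [card_insert_of_notMem huC, hC, card_univ] at hdel
      rw [show #(foot G f u) = 5 by omega] at h2 h3
      omega
    · by_contra! h
      have hCT : univ.image f ⊆ T := (subset_insert _ _).trans hT.subset
      have hT' : univ.image f ∪ T \ univ.image f = T := union_sdiff_of_subset hCT
      have hall := card_foot_eq_of_five_le_ten hN hconn hf hmax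
        (D := T \ univ.image f) forall_ne_of_disjoint_image (by
          intro z hz
          rw [hT']
          by_cases hzu : z = u
          · exact h5.trans (by rw [hzu, ← nbrCount_image hf]; exact nbrCount_mono G hCT u)
          · have := h z (by simp_all)
            omega)
      obtain ⟨w, hwT, hwS⟩ := exists_of_ssubset hT
      have hw := mem_sdiff.2 ⟨hwT, fun h => hwS (mem_insert_of_mem h)⟩
      have h6 := h w (mem_sdiff.2 ⟨hwT, hwS⟩)
      rw [hT'] at hall
      have := card_le_five_of_sparse_ten
        (foot_add_one_notMem (by norm_num) hf hmax (forall_ne_of_disjoint_image w hw))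
      rw [hall w hw] at this
      omega
  · push Not at hu
    left
    have hdel := degSum_le_of_exists_nbrCount_le G 4 (univ.image f) (fun T hT => ?_)
      univ (subset_univ _)
    · have := degSum_le_card_mul G (univ.image f)
      rw [hC, card_univ] at hdel
      rw [hC] at this
      omega
    · by_contra! h
      have hT' : univ.image f ∪ T \ univ.image f = T := union_sdiff_of_subset hT.subset
      have hall := card_foot_eq_of_five_le_ten hN hconn hf hmax
        (D := T \ univ.image f) forall_ne_of_disjoint_image (by rwa [hT'])
      obtain ⟨w, hwT, hwS⟩ := exists_of_ssubset hT
      have hw := mem_sdiff.2 ⟨hwT, hwS⟩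
      have h1 := h w hw
      have h2 := hall w hw
      have h3 := hu w (forall_ne_of_disjoint_image w hw)
      rw [hT'] at h2
      omega

end CycleTen

section CycleTwelve

variable {V : Type*} {G : SimpleGraph V} {f : ZMod 12 → V}

theorem IsCycleMap.isPathList_cons_arc {c : ℕ} {f : ZMod c → V} (hf : IsCycleMap G f) {u : V}
    (hu : ∀ i, f i ≠ u) {i : ZMod c} (hi : G.Adj u (f i)) {m : ℕ} (hm : m ≤ c) :
    IsPathList G (u :: arc f i m) := by
  refine isPathList_cons.2 ⟨isPathList_arc hf i hm, fun h => ?_, fun x hx => ?_⟩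
  · obtain ⟨k, -, hk⟩ := mem_arc.1 h
    exact hu _ hk
  · obtain rfl | hm0 := m.eq_zero_or_pos
    · simp [arc] at hx
    · rw [head?_arc _ _ hm0, Option.mem_some] at hx
      exact hx ▸ hi

theorem IsCycleMap.isPathList_arc_append {c : ℕ} {f : ZMod c → V} (hf : IsCycleMap G f) {u : V}
    (hu : ∀ i, f i ≠ u) {i : ZMod c} {m : ℕ} (hi : G.Adj u (f (i + m))) (hm : m + 1 ≤ c) :
    IsPathList G (arc f i (m + 1) ++ [u]) := by
  refine isPathList_append.2 ⟨isPathList_arc hf i hm, ⟨by simp, by simp⟩, ?_, ?_⟩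
  · intro x hx hx'
    obtain ⟨k, -, hk⟩ := mem_arc.1 hx
    exact hu _ (hk.trans (List.mem_singleton.1 hx'))
  · intro x hx y hy
    rw [getLast?_arc _ _ (by omega), Option.mem_some, Nat.add_sub_cancel] at hx
    simp only [List.head?_cons, Option.mem_some] at hy
    exact hx ▸ hy ▸ hi.symm

/-- Two vertices outside a cycle of length `12` in a `2P₇`-free graph cannot be attached at
consecutive vertices, at opposite vertices, or at vertices at distance four. -/
theorem attachments_twelve (hfree : ¬ Contains TwoP7 G) (hf : IsCycleMap G f) {u w : V}
    (hu : ∀ i, f i ≠ u) (hw : ∀ i, f i ≠ w) (huw : u ≠ w) {i j : ZMod 12} (hi : G.Adj u (f i))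
    (hj : G.Adj w (f j)) : j ≠ i + 1 ∧ j ≠ i + 4 ∧ j ≠ i + 6 := by
  have hua : ∀ (i : ZMod 12) (m : ℕ), u ∉ arc f i m := fun i m h => by
    obtain ⟨k, -, hk⟩ := mem_arc.1 h
    exact hu _ hk
  have hwa : ∀ (i : ZMod 12) (m : ℕ), w ∉ arc f i m := fun i m h => by
    obtain ⟨k, -, hk⟩ := mem_arc.1 h
    exact hw _ hk
  refine ⟨?_, ?_, ?_⟩ <;> rintro rfl <;> refine hfree ?_
  · have hi' : i - 5 + ((5 : ℕ) : ZMod 12) = i := by push_cast; ring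
    have hi'' : i - 5 + ((6 : ℕ) : ZMod 12) = i + 1 := by push_cast; ring
    refine contains_twoP7 (hf.isPathList_arc_append hu (i := i - 5) (m := 5) (by rwa [hi'])
      (by norm_num)) (hf.isPathList_cons_arc hw hj (m := 6) (by norm_num)) ?_
      (by simp [length_arc]) (by simp [length_arc])
    have hd := arc_disjoint hf (i - 5) (m := 6) (m' := 6) (by norm_num)
    rw [hi''] at hd
    simp [List.disjoint_cons_right, hd, hwa, hua, huw.symm]
  · have hd := arc_disjoint hf i (m := 5) (m' := 7) (by norm_num)
    have hp := hf.isPathList_arc_append hw (i := i) (m := 4) (by exact_mod_cast hj) (by norm_num)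
    refine contains_twoP7 (l₁ := u :: (arc f i 5 ++ [w])) (isPathList_cons.2 ⟨hp, ?_, ?_⟩)
      (isPathList_arc hf (i + (5 : ℕ)) (m := 7) (by norm_num)) ?_
      (by simp [length_arc]) (by simp [length_arc])
    · simp [hua, huw]
    · intro x hx
      rw [List.head?_append, head?_arc _ _ (by norm_num), Option.some_or, Option.mem_some] at hx
      exact hx ▸ hi
    · simpa [List.disjoint_cons_left, List.disjoint_append_left, hwa, hua] using hd
  · have hd := arc_disjoint hf i (m := 6) (m' := 6) (by norm_num)
    refine contains_twoP7 (hf.isPathList_cons_arc hu hi (m := 6) (by norm_num))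
      (hf.isPathList_cons_arc hw hj (m := 6) (by norm_num)) ?_
      (by simp [length_arc]) (by simp [length_arc])
    simpa [List.disjoint_cons_left, List.disjoint_cons_right, hwa, hua, huw.symm] using hd

variable [DecidableRel G.Adj]

theorem foot_subset_compatible (hfree : ¬ Contains TwoP7 G) (hf : IsCycleMap G f) {u w : V}
    (hu : ∀ i, f i ≠ u) (hw : ∀ i, f i ≠ w) (huw : u ≠ w) :
    foot G f w ⊆ compatible (foot G f u) := by
  intro j hj
  rw [mem_foot] at hj
  refine mem_filter.2 ⟨mem_univ _, fun i hi => ?_⟩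
  rw [mem_foot] at hi
  obtain ⟨h1, h4, h6⟩ := attachments_twelve hfree hf hu hw huw hi hj
  obtain ⟨h1', h4', -⟩ := attachments_twelve hfree hf hw hu huw.symm hj hi
  refine ⟨h1, fun h => h1' ?_, h4, fun h => h4' ?_, h6⟩
  · rw [h, sub_add_cancel]
  · rw [h, sub_add_cancel]

theorem degSum_univ_le_of_longest_cycle_twelve [DecidableEq V] [Fintype V]
    (hfree : ¬ Contains TwoP7 G)
    (hconn : G.Connected) (hf : IsCycleMap G f) (hmax : ∀ l, IsCycleList G l → l.length ≤ 12)
    (hn : 14 ≤ Fintype.card V) :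
    degSum G univ ≤ 6 * Fintype.card V + 58 ∨ degSum G univ ≤ 8 * Fintype.card V + 14 := by
  have hN : ∀ l, IsPathList G l → l.length ≤ 13 := fun l hl => hl.length_le_thirteen hfree
  set D := (univ : Finset V) \ univ.image f with hD
  have hDf : ∀ z ∈ D, ∀ i, f i ≠ z := forall_ne_of_disjoint_image
  have hatt : ∀ z ∈ D, (foot G f z).Nonempty := by
    intro z hz
    obtain ⟨p, hp⟩ := exists_isTail hconn (hDf z hz)
    have hlen := hp.length_add_le hN hf
    obtain rfl : p = [] := List.length_eq_zero_iff.1 (by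
      rw [List.length_cons] at hlen
      omega)
    obtain ⟨x, hx, i, hi⟩ := hp.2.2
    obtain rfl : z = x := by simpa using hx
    exact ⟨i, mem_foot.2 hi⟩
  have hind : ∀ z ∈ D, ∀ z' ∈ D, ¬ G.Adj z z' := by
    intro z hz z' hz' hadj
    obtain ⟨i, hi⟩ := hatt z' hz'
    have := ((isTail_singleton (hDf z' hz') (mem_foot.1 hi)).cons hadj
      (by simpa using hadj.ne) (hDf z hz)).length_add_le hN hf
    simp at this
  have hC := card_image_cycle hf
  have hCD : (univ : Finset V) \ D = univ.image f := by
    rw [hD, Finset.sdiff_sdiff_eq_self (subset_univ _)]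
  have hcardD : #D + 12 = Fintype.card V := by
    rw [← hC, hD, card_sdiff_add_card_eq_card (subset_univ _), card_univ]
  have hU : univ.image f ∪ D = univ := by rw [hD, union_sdiff_of_subset (subset_univ _)]
  have hsum : degSum G univ = degSum G (univ.image f) + 2 * ∑ z ∈ D, #(foot G f z) := by
    have h1 : ∑ z ∈ D, nbrCount G univ z = ∑ z ∈ D, #(foot G f z) := by
      refine sum_congr rfl fun z hz => ?_
      rw [card_foot_of_independent hf hDf (hind z hz), hU]
    have h2 : ∑ z ∈ D, nbrCount G (univ.image f) z = ∑ z ∈ D, #(foot G f z) :=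
      sum_congr rfl fun z _ => nbrCount_image hf z
    rw [degSum_eq_of_subset G (subset_univ D), hCD, two_mul, h1, h2]
  have hDne : D.Nonempty := card_pos.1 (by omega)
  obtain ⟨u, huD, humax⟩ := exists_max_image D (fun z => #(foot G f z)) hDne
  have hshift := degSum_image_add_le hf (shiftPairs (foot G f u)) fun x hx =>
    not_adj_of_mem_shiftPairs hf hmax (hDf u huD) hx
  have hsumle : ∑ z ∈ D, #(foot G f z) ≤ #D * #(foot G f u) := sum_le_card_nsmul _ _ _ humax
  have hsq := le_card_shiftPairs (foot G f u)
  rcases Nat.lt_or_ge #(foot G f u) 4 with h4 | h4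
  · left
    have hmul : #D * #(foot G f u) ≤ #D * 2 ∨ #(foot G f u) = 3 := by
      rcases Nat.lt_or_ge #(foot G f u) 3 with h3 | h3
      · exact .inl (Nat.mul_le_mul_left _ (by omega))
      · exact .inr (by omega)
    rcases hmul with hmul | h3
    · omega
    · rw [h3] at hsumle hsq
      omega
  · obtain ⟨w, hwD, hwu⟩ := exists_mem_ne (by omega : 1 < #D) u
    have hcomp : ∀ z ∈ D.erase u, #(foot G f z) ≤ #(compatible (foot G f u)) := by
      intro z hz
      rw [mem_erase] at hz
      exact card_le_card (foot_subset_compatible hfree hf (hDf u huD) (hDf z hz.2) hz.1.symm)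
    have hne : (compatible (foot G f u)).Nonempty :=
      (hatt w hwD).mono (foot_subset_compatible hfree hf (hDf u huD) (hDf w hwD) hwu.symm)
    obtain ⟨h5, h18, hcases⟩ := card_shiftPairs_twelve (foot G f u)
      (foot_add_one_notMem (by norm_num) hf hmax (hDf u huD)) h4 hne
    have hsplit := add_sum_erase D (fun z => #(foot G f z)) huD
    have hle : ∑ z ∈ D.erase u, #(foot G f z) ≤ #(D.erase u) * #(compatible (foot G f u)) :=
      sum_le_card_nsmul _ _ _ hcomp
    have hcard := card_erase_add_one huD
    rcases hcases with h3 | ⟨h4', ha, h22⟩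
    · have := Nat.mul_le_mul_left #(D.erase u) h3
      left
      omega
    · have := Nat.mul_le_mul_left #(D.erase u) h4'
      right
      omega

end CycleTwelve

section CoreGraph

variable {V : Type*}

theorem exists_three {S : Finset V} (h : 3 ≤ #S) :
    ∃ a ∈ S, ∃ b ∈ S, ∃ c ∈ S, [a, b, c].Nodup := by
  obtain ⟨a, b, c, ha, hb, hc, h1, h2, h3⟩ := two_lt_card_iff.1 h
  exact ⟨a, ha, b, hb, c, hc, by simp [h1, h2, h3]⟩

variable [DecidableEq V]

/-- The graph in which the vertices of `A` are joined to all others and the only remaining edge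
is `pq`. -/
def coreGraph (A : Finset V) (p q : V) : SimpleGraph V where
  Adj x y := x ≠ y ∧ (x ∈ A ∨ y ∈ A ∨ (x = p ∧ y = q) ∨ (x = q ∧ y = p))
  symm := ⟨fun x y h => by tauto⟩
  loopless := ⟨fun x h => h.1 rfl⟩

instance (A : Finset V) (p q : V) : DecidableRel (coreGraph A p q).Adj := fun x y =>
  inferInstanceAs (Decidable (x ≠ y ∧ (x ∈ A ∨ y ∈ A ∨ (x = p ∧ y = q) ∨ (x = q ∧ y = p))))

theorem coreGraph_adj {A : Finset V} {p q x y : V} : (coreGraph A p q).Adj x y ↔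
    x ≠ y ∧ (x ∈ A ∨ y ∈ A ∨ (x = p ∧ y = q) ∨ (x = q ∧ y = p)) := Iff.rfl

theorem degSum_coreGraph {A : Finset V} {p q : V} (hA : #A = 5) (hp : p ∉ A) (hq : q ∉ A)
    (hpq : p ≠ q) {T : Finset V} (hAT : A ⊆ T) (hpT : p ∈ T) (hqT : q ∈ T) :
    degSum (coreGraph A p q) T + 28 = 10 * #T := by
  have hpair : ({p, q} : Finset V) ⊆ T \ A := by
    intro x hx
    rcases mem_insert.1 hx with rfl | hx
    · exact mem_sdiff.2 ⟨hpT, hp⟩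
    · rw [mem_singleton.1 hx]
      exact mem_sdiff.2 ⟨hqT, hq⟩
  have h1 : ∀ x ∈ A, nbrCount (coreGraph A p q) T x = #T - 1 := by
    intro x hx
    rw [nbrCount, ← card_erase_of_mem (hAT hx)]
    congr 1
    ext y
    simp only [mem_filter, mem_erase, coreGraph_adj]
    tauto
  have h2 : ∀ x ∈ ({p, q} : Finset V), nbrCount (coreGraph A p q) T x = 6 := by
    intro x hx
    rcases mem_insert.1 hx with rfl | hx
    · rw [nbrCount, show 6 = #A + 1 by rw [hA], ← card_insert_of_notMem hq]
      congr 1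
      ext y
      simp only [mem_filter, mem_insert, coreGraph_adj]
      grind
    · rw [mem_singleton.1 hx, nbrCount, show 6 = #A + 1 by rw [hA],
        ← card_insert_of_notMem hp]
      congr 1
      ext y
      simp only [mem_filter, mem_insert, coreGraph_adj]
      grind
  have h3 : ∀ x ∈ (T \ A) \ {p, q}, nbrCount (coreGraph A p q) T x = 5 := by
    intro x hx
    rw [nbrCount, ← hA]
    congr 1
    ext y
    simp only [mem_filter, coreGraph_adj]
    simp only [mem_sdiff, mem_insert, mem_singleton] at hx
    grind
  have hc1 := card_sdiff_add_card_eq_card hAT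
  have hc2 := card_sdiff_add_card_eq_card hpair
  rw [card_pair hpq] at hc2
  rw [degSum, ← sum_sdiff hAT, ← sum_sdiff hpair, sum_const_nat h1, sum_const_nat h2,
    sum_const_nat h3, card_pair hpq, hA]
  omega

variable {G : SimpleGraph V} [DecidableRel G.Adj]

theorem degSum_add_two_le {H : SimpleGraph V} [DecidableRel H.Adj] {T : Finset V}
    (h : ∀ x ∈ T, ∀ y ∈ T, G.Adj x y → H.Adj x y) {x y : V} (hx : x ∈ T) (hy : y ∈ T)
    (hxy : H.Adj x y) (hxy' : ¬ G.Adj x y) : degSum G T + 2 ≤ degSum H T := by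
  have hlt : ∀ a ∈ T, ∀ b ∈ T, H.Adj a b → ¬ G.Adj a b → nbrCount G T a < nbrCount H T a := by
    intro a ha b hb hab hab'
    refine card_lt_card ⟨fun z hz => ?_, fun hsub => ?_⟩
    · rw [mem_filter] at hz ⊢
      exact ⟨hz.1, h a ha z hz.1 hz.2⟩
    · exact hab' (mem_filter.1 (hsub (mem_filter.2 ⟨hb, hab⟩))).2
  have hle : ∑ z ∈ (T.erase x).erase y, nbrCount G T z ≤
      ∑ z ∈ (T.erase x).erase y, nbrCount H T z := by
    refine sum_le_sum fun a ha => card_le_card fun z hz => ?_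
    rw [mem_filter] at hz ⊢
    exact ⟨hz.1, h a (mem_of_mem_erase (mem_of_mem_erase ha)) z hz.1 hz.2⟩
  have h1 := hlt x hx y hy hxy hxy'
  have h2 := hlt y hy x hx hxy.symm fun h => hxy' h.symm
  have hyx : y ∈ T.erase x := mem_erase.2 ⟨hxy.ne', hy⟩
  rw [degSum, degSum, ← add_sum_erase T _ hx, ← add_sum_erase _ _ hyx,
    ← add_sum_erase T (fun z => nbrCount H T z) hx, ← add_sum_erase (T.erase x) _ hyx]
  omega

theorem exists_four {S : Finset V} (h : 4 ≤ #S) :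
    ∃ a ∈ S, ∃ b ∈ S, ∃ c ∈ S, ∃ d ∈ S, [a, b, c, d].Nodup := by
  obtain ⟨a, ha⟩ := card_pos.1 (by omega : 0 < #S)
  obtain ⟨b, hb, c, hc, d, hd, hn⟩ := exists_three (S := S.erase a) (by
    rw [card_erase_of_mem ha]
    omega)
  rw [mem_erase] at hb hc hd
  exact ⟨a, ha, b, hb.2, c, hc.2, d, hd.2,
    List.nodup_cons.2 ⟨by simp [hb.1.symm, hc.1.symm, hd.1.symm], hn⟩⟩

/-- If `G` agrees with a core graph on `T` and has no long cycle, then every outside vertex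
with at least five neighbours in `T` is adjacent precisely to the vertices of `A`. -/
theorem adj_iff_mem_of_coreGraph {A T : Finset V} {p q w : V} (hA : #A = 5) (hp : p ∉ A)
    (hq : q ∉ A) (hpq : p ≠ q) (hAT : A ⊆ T) (hpT : p ∈ T) (hqT : q ∈ T) (hT : 12 ≤ #T)
    (hcore : ∀ x ∈ T, ∀ y ∈ T, (coreGraph A p q).Adj x y → G.Adj x y)
    (hmax : ∀ l, IsCycleList G l → l.length ≤ 11) (hw : w ∉ T) (h5 : 5 ≤ nbrCount G T w) :
    ∀ y ∈ T, G.Adj w y ↔ y ∈ A := by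
  set I := (T \ A) \ {p, q} with hI
  have hpair : ({p, q} : Finset V) ⊆ T \ A := by
    intro x hx
    rcases mem_insert.1 hx with rfl | hx
    · exact mem_sdiff.2 ⟨hpT, hp⟩
    · rw [mem_singleton.1 hx]
      exact mem_sdiff.2 ⟨hqT, hq⟩
  have hcardI : 5 ≤ #I := by
    have hc1 := card_sdiff_add_card_eq_card hAT
    have hc2 := card_sdiff_add_card_eq_card hpair
    rw [card_pair hpq, ← hI] at hc2
    omega
  have hadj : ∀ a ∈ A, ∀ x ∈ T, x ∉ A → G.Adj a x ∧ G.Adj x a := fun a ha x hx hxA =>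
    have h := hcore a (hAT ha) x hx ⟨fun h => hxA (h ▸ ha), .inl ha⟩
    ⟨h, h.symm⟩
  have hadjpq : G.Adj p q := hcore p hpT q hqT ⟨hpq, by tauto⟩
  have hIT : ∀ x ∈ I, x ∈ T ∧ x ∉ A ∧ x ≠ p ∧ x ≠ q := by
    intro x hx
    simp only [hI, mem_sdiff, mem_insert, mem_singleton, not_or] at hx
    tauto
  have hadjI : ∀ a ∈ A, ∀ x ∈ I, G.Adj a x ∧ G.Adj x a := fun a ha x hx =>
    hadj a ha x (hIT x hx).1 (hIT x hx).2.1
  have hIA : ∀ x ∈ I, ∀ y ∈ A, G.Adj w x → ¬ G.Adj w y := by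
    intro x hx y hy hwx hwy
    obtain ⟨a₁, ha₁, a₂, ha₂, a₃, ha₃, a₄, ha₄, hn⟩ := exists_four (S := A.erase y) (by
      rw [card_erase_of_mem hy]
      omega)
    obtain ⟨s₁, hs₁, s₂, hs₂, s₃, hs₃, hn'⟩ := exists_three (S := I.erase x) (by
      rw [card_erase_of_mem hx]
      omega)
    have := hmax [w, x, a₁, s₁, a₂, s₂, a₃, s₃, a₄, p, q, y] (by
      simp only [mem_erase] at ha₁ ha₂ ha₃ ha₄ hs₁ hs₂ hs₃
      simp only [List.nodup_cons, List.mem_cons, List.not_mem_nil, or_false, not_or] at hn hn'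
      refine ⟨⟨?_, ?_⟩, by simp, by simpa using hwy.symm⟩
      · simp only [List.isChain_cons_cons, List.isChain_singleton, and_true]
        exact ⟨hwx, (hadjI a₁ ha₁.2 x hx).2, (hadjI a₁ ha₁.2 s₁ hs₁.2).1,
          (hadjI a₂ ha₂.2 s₁ hs₁.2).2, (hadjI a₂ ha₂.2 s₂ hs₂.2).1, (hadjI a₃ ha₃.2 s₂ hs₂.2).2,
          (hadjI a₃ ha₃.2 s₃ hs₃.2).1, (hadjI a₄ ha₄.2 s₃ hs₃.2).2, (hadj a₄ ha₄.2 p hpT hp).1,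
          hadjpq, (hadj y hy q hqT hq).2⟩
      · clear hadj hadjI hcore hmax hI hpair
        clear_value I
        simp only [List.nodup_cons, List.mem_cons, List.not_mem_nil, or_false, not_or]
        and_intros <;> grind)
    simp at this
  have hII : ∀ x ∈ I, ∀ y ∈ I, x ≠ y → G.Adj w x → ¬ G.Adj w y := by
    intro x hx y hy hxy hwx hwy
    obtain ⟨a₅, ha₅⟩ := card_pos.1 (by omega : 0 < #A)
    obtain ⟨a₁, ha₁, a₂, ha₂, a₃, ha₃, a₄, ha₄, hn⟩ := exists_four (S := A.erase a₅) (by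
      rw [card_erase_of_mem ha₅]
      omega)
    obtain ⟨s₁, hs₁, s₂, hs₂, s₃, hs₃, hn'⟩ := exists_three (S := (I.erase x).erase y) (by
      rw [card_erase_of_mem (mem_erase.2 ⟨hxy.symm, hy⟩), card_erase_of_mem hx]
      omega)
    have := hmax [w, x, a₁, s₁, a₂, s₂, a₃, s₃, a₄, p, q, a₅, y] (by
      simp only [mem_erase] at ha₁ ha₂ ha₃ ha₄ hs₁ hs₂ hs₃
      simp only [List.nodup_cons, List.mem_cons, List.not_mem_nil, or_false, not_or] at hn hn'
      refine ⟨⟨?_, ?_⟩, by simp, by simpa using hwy.symm⟩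
      · simp only [List.isChain_cons_cons, List.isChain_singleton, and_true]
        exact ⟨hwx, (hadjI a₁ ha₁.2 x hx).2, (hadjI a₁ ha₁.2 s₁ hs₁.2.2).1,
          (hadjI a₂ ha₂.2 s₁ hs₁.2.2).2, (hadjI a₂ ha₂.2 s₂ hs₂.2.2).1,
          (hadjI a₃ ha₃.2 s₂ hs₂.2.2).2, (hadjI a₃ ha₃.2 s₃ hs₃.2.2).1,
          (hadjI a₄ ha₄.2 s₃ hs₃.2.2).2, (hadj a₄ ha₄.2 p hpT hp).1, hadjpq,
          (hadj a₅ ha₅ q hqT hq).2, (hadjI a₅ ha₅ y hy).1⟩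
      · clear hadj hadjI hcore hmax hI hpair hIA
        clear_value I
        simp only [List.nodup_cons, List.mem_cons, List.not_mem_nil, or_false, not_or]
        and_intros <;> grind)
    simp at this
  have hpA : ∀ x ∈ T, ∀ x' ∈ T, x ∉ A → x' ∉ A → x ∉ I → x' ∉ I → G.Adj x x' →
      ∀ y ∈ A, G.Adj w x → ¬ G.Adj w y := by
    intro x hxT x' hxT' hxA hxA' hxI hxI' hxx' y hy hwx hwy
    obtain ⟨a₁, ha₁, a₂, ha₂, a₃, ha₃, a₄, ha₄, hn⟩ := exists_four (S := A.erase y) (by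
      rw [card_erase_of_mem hy]
      omega)
    obtain ⟨s₁, hs₁, s₂, hs₂, s₃, hs₃, s₄, hs₄, hn'⟩ := exists_four (by omega : 4 ≤ #I)
    have := hmax [w, x, x', a₁, s₁, a₂, s₂, a₃, s₃, a₄, s₄, y] (by
      simp only [mem_erase] at ha₁ ha₂ ha₃ ha₄
      simp only [List.nodup_cons, List.mem_cons, List.not_mem_nil, or_false, not_or] at hn hn'
      refine ⟨⟨?_, ?_⟩, by simp, by simpa using hwy.symm⟩
      · simp only [List.isChain_cons_cons, List.isChain_singleton, and_true]
        exact ⟨hwx, hxx', (hadj a₁ ha₁.2 x' hxT' hxA').2, (hadjI a₁ ha₁.2 s₁ hs₁).1,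
          (hadjI a₂ ha₂.2 s₁ hs₁).2, (hadjI a₂ ha₂.2 s₂ hs₂).1, (hadjI a₃ ha₃.2 s₂ hs₂).2,
          (hadjI a₃ ha₃.2 s₃ hs₃).1, (hadjI a₄ ha₄.2 s₃ hs₃).2, (hadjI a₄ ha₄.2 s₄ hs₄).1,
          (hadjI y hy s₄ hs₄).2⟩
      · have hne := hxx'.ne
        clear hadj hadjI hcore hmax hI hpair hIA hII
        clear_value I
        simp only [List.nodup_cons, List.mem_cons, List.not_mem_nil, or_false, not_or]
        and_intros <;> grind)
    simp at this
  have hNA : T.filter (G.Adj w) ⊆ A := by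
    by_cases hex : ∃ y ∈ A, G.Adj w y
    · obtain ⟨y, hy, hwy⟩ := hex
      intro x hx
      obtain ⟨hxT, hwx⟩ := mem_filter.1 hx
      by_contra hxA
      by_cases hxI : x ∈ I
      · exact hIA x hxI y hy hwx hwy
      · obtain rfl | rfl : x = p ∨ x = q := by
          by_contra h
          exact hxI (by simp only [hI, mem_sdiff, mem_insert, mem_singleton]; tauto)
        · exact hpA x hxT q hqT hxA hq hxI (fun h => (hIT q h).2.2.2 rfl) hadjpq y hy hwx hwy
        · exact hpA x hxT p hpT hxA hp hxI (fun h => (hIT p h).2.2.1 rfl) hadjpq.symm y hy hwx hwy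
    · push Not at hex
      exfalso
      have hsub : T.filter (G.Adj w) ⊆ I.filter (G.Adj w) ∪ {p, q} := by
        intro x hx
        obtain ⟨hxT, hwx⟩ := mem_filter.1 hx
        simp only [hI, mem_union, mem_filter, mem_sdiff, mem_insert, mem_singleton]
        have := fun h => hex x h hwx
        tauto
      have h3 : 1 < #(I.filter (G.Adj w)) := by
        have h1 := (card_le_card hsub).trans (card_union_le _ _)
        rw [card_pair hpq] at h1
        rw [nbrCount] at h5
        omega
      obtain ⟨x, hx, y, hy, hxy⟩ := one_lt_card.1 h3
      rw [mem_filter] at hx hy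
      exact hII x hx.1 y hy.1 hxy hx.2 hy.2
  have hNA' : T.filter (G.Adj w) = A := eq_of_subset_of_card_le hNA (by rw [hA]; exact h5)
  intro y hy
  rw [← hNA', mem_filter]
  simp [hy]

end CoreGraph

section CycleEleven

variable {V : Type*} {G : SimpleGraph V} {f : ZMod 11 → V}

theorem IsCycleMap.comp_add_left {c : ℕ} {f : ZMod c → V} (hf : IsCycleMap G f) (t : ZMod c) :
    IsCycleMap G fun i => f (t + i) :=
  ⟨fun i j hij => add_left_cancel (hf.1 hij), fun i => by
    simpa only [add_assoc] using hf.2 (t + i)⟩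

variable [DecidableRel G.Adj]

theorem degSum_congr {H : SimpleGraph V} [DecidableRel H.Adj] {T : Finset V}
    (h : ∀ x ∈ T, ∀ y ∈ T, G.Adj x y ↔ H.Adj x y) : degSum G T = degSum H T :=
  sum_congr rfl fun x hx => congrArg card (filter_congr (h x hx))

variable [DecidableEq V]

theorem degSum_univ_le_of_foot_le_four [Fintype V]
    (hN : ∀ l, IsPathList G l → l.length ≤ 13) (hconn : G.Connected) (hf : IsCycleMap G f)
    (hmax : ∀ l, IsCycleList G l → l.length ≤ 11)
    (hfoot : ∀ u, (∀ i, f i ≠ u) → #(foot G f u) ≤ 4) :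
    degSum G univ ≤ 7 * Fintype.card V + 33 ∨ degSum G univ ≤ 8 * Fintype.card V + 10 := by
  have hC := card_image_cycle hf
  by_cases hu : ∃ u, (∀ i, f i ≠ u) ∧ 4 ≤ #(foot G f u)
  · obtain ⟨u, hu, h4⟩ := hu
    right
    have h1 := degSum_image_add_le hf (shiftPairs (foot G f u)) fun x hx =>
      not_adj_of_mem_shiftPairs hf hmax hu hx
    have h2 := card_shiftPairs_eleven _ (foot_add_one_notMem (by norm_num) hf hmax hu) h4
    have hdel := degSum_le_of_exists_nbrCount_le G 4 (univ.image f) (fun T hT => ?_)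
      univ (subset_univ _)
    · rw [hC, card_univ] at hdel
      omega
    · by_contra! h
      have hT' : univ.image f ∪ T \ univ.image f = T := union_sdiff_of_subset hT.subset
      have hall := card_foot_eq_of_five_le_eleven hN hconn hf hmax
        (D := T \ univ.image f) forall_ne_of_disjoint_image (by rwa [hT'])
      obtain ⟨w, hwT, hwS⟩ := exists_of_ssubset hT
      have hw := mem_sdiff.2 ⟨hwT, hwS⟩
      have h3 := h w hw
      have h5 := hall w hw
      have h6 := hfoot w (forall_ne_of_disjoint_image w hw)
      rw [hT'] at h5
      omega
  · push Not at hu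
    left
    have hdel := degSum_le_of_deletable G 7 (univ.image f) (fun T hT => ?_) univ (subset_univ _)
    · have := degSum_le_card_mul G (univ.image f)
      rw [hC, card_univ] at hdel
      rw [hC] at this
      omega
    · by_contra! h
      have hT' : univ.image f ∪ T \ univ.image f = T := union_sdiff_of_subset hT.subset
      have hD : ∀ z ∈ T \ univ.image f, ∀ i, f i ≠ z := forall_ne_of_disjoint_image
      have h4 : ∀ z ∈ T \ univ.image f, 4 ≤ nbrCount G T z := by
        intro z hz
        have h1 := h {z} (singleton_subset_iff.2 hz) (singleton_nonempty z)
        have h2 := nbrCount_mono G (sdiff_subset : T \ {z} ⊆ T) z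
        rw [sum_singleton, sum_singleton, card_singleton] at h1
        omega
      rcases attached_or_exists_farFrom hN hconn hf hmax hD fun z hz => .inr (by
        have := h4 z hz
        rw [hT']
        omega) with hA | ⟨a, ha, b, hb, q, hab, hadj, h2, hq, hqa, hqb, -⟩
      · obtain ⟨w, hwT, hwS⟩ := exists_of_ssubset hT
        have hw := mem_sdiff.2 ⟨hwT, hwS⟩
        have h5 := card_foot_of_independent hf hD (hA w hw).2
        rw [hT'] at h5
        have := h4 w hw
        have := hu w (hD w hw)
        omega
      · obtain rfl : q = 2 := by omega
        have hX : ({a, b} : Finset V) ⊆ T \ univ.image f := by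
          simp [insert_subset_iff, ha, hb]
        have hXT : ({a, b} : Finset V) ⊆ T := hX.trans sdiff_subset
        have h1 := h {a, b} hX ⟨a, mem_insert_self a _⟩
        rw [sum_pair hab, sum_pair hab, card_pair hab] at h1
        have ha1 := nbrCount_image_union hf hD a
        have hb1 := nbrCount_image_union hf hD b
        rw [hT'] at ha1 hb1
        have ha2 := nbrCount_sdiff G hXT a
        have hb2 := nbrCount_sdiff G hXT b
        have ha3 : 0 < nbrCount G {a, b} a := card_pos.2 ⟨b, by simp [hadj rfl]⟩
        have hb3 : 0 < nbrCount G {a, b} b := card_pos.2 ⟨a, by simp [(hadj rfl).symm]⟩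
        have := hu a (hD a ha)
        have := hu b (hD b hb)
        omega

theorem exists_nbrCount_le_five_of_ssubset
    (hN : ∀ l, IsPathList G l → l.length ≤ 13) (hconn : G.Connected) (hf : IsCycleMap G f)
    (hmax : ∀ l, IsCycleList G l → l.length ≤ 11) {S T : Finset V} (hS : univ.image f ⊆ S)
    (hfoot : ∀ z ∈ S \ univ.image f, 5 ≤ #(foot G f z)) (hT : S ⊂ T) :
    ∃ w ∈ T \ S, nbrCount G T w ≤ 5 := by
  by_contra! h
  have hCT : univ.image f ⊆ T := hS.trans hT.subset
  have hT' : univ.image f ∪ T \ univ.image f = T := union_sdiff_of_subset hCT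
  have hall := card_foot_eq_of_five_le_eleven hN hconn hf hmax
    (D := T \ univ.image f) forall_ne_of_disjoint_image (by
      intro z hz
      rw [hT']
      rw [mem_sdiff] at hz
      by_cases hzS : z ∈ S
      · refine (hfoot z (mem_sdiff.2 ⟨hzS, hz.2⟩)).trans ?_
        rw [← nbrCount_image hf]
        exact nbrCount_mono G hCT z
      · exact (h z (mem_sdiff.2 ⟨hz.1, hzS⟩)).le)
  obtain ⟨w, hwT, hwS⟩ := exists_of_ssubset hT
  have hw := mem_sdiff.2 ⟨hwT, fun h => hwS (hS h)⟩
  have h6 := h w (mem_sdiff.2 ⟨hwT, hwS⟩)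
  have h5 := card_le_five_of_sparse_eleven
    (foot_add_one_notMem (by norm_num) hf hmax (forall_ne_of_disjoint_image w hw))
  rw [hT'] at hall
  rw [hall w hw] at h5
  omega

theorem coreGraph_adj_of_foot_eq (hf : IsCycleMap G f)
    (hmax : ∀ l, IsCycleList G l → l.length ≤ 11) {u : V} (hu : ∀ i, f i ≠ u)
    (hfoot : foot G f u = {0, 2, 4, 6, 8}) :
    ∀ x ∈ insert u (univ.image f), ∀ y ∈ insert u (univ.image f), G.Adj x y →
      (coreGraph (({0, 2, 4, 6, 8} : Finset (ZMod 11)).image f) (f 9) (f 10)).Adj x y := by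
  have huf : ∀ i, G.Adj u (f i) → f i ∈ ({0, 2, 4, 6, 8} : Finset (ZMod 11)).image f :=
    fun i hi => mem_image_of_mem f (hfoot ▸ mem_foot.2 hi)
  have hpairs : ∀ x : ZMod 11 × ZMod 11, x ∉ shiftPairs ({0, 2, 4, 6, 8} : Finset (ZMod 11)) →
      x.1 ≠ x.2 → x.1 ∈ ({0, 2, 4, 6, 8} : Finset (ZMod 11)) ∨
        x.2 ∈ ({0, 2, 4, 6, 8} : Finset (ZMod 11)) ∨ (x.1 = 9 ∧ x.2 = 10) ∨
          (x.1 = 10 ∧ x.2 = 9) := by decide +kernel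
  intro x hx y hy hxy
  refine ⟨hxy.ne, ?_⟩
  rcases mem_insert.1 hx with rfl | hx
  · rcases mem_insert.1 hy with rfl | hy
    · exact absurd hxy G.irrefl
    · obtain ⟨j, -, rfl⟩ := mem_image.1 hy
      exact .inr (.inl (huf j hxy))
  · obtain ⟨i, -, rfl⟩ := mem_image.1 hx
    rcases mem_insert.1 hy with rfl | hy
    · exact .inl (huf i hxy.symm)
    · obtain ⟨j, -, rfl⟩ := mem_image.1 hy
      have h := hpairs (i, j) (fun h => (not_adj_of_mem_shiftPairs hf hmax hu (hfoot ▸ h)).2 hxy)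
        fun h => hxy.ne (congrArg f h)
      rcases h with h | h | ⟨rfl, rfl⟩ | ⟨rfl, rfl⟩
      · exact .inl (mem_image_of_mem f h)
      · exact .inr (.inl (mem_image_of_mem f h))
      · exact .inr (.inr (.inl ⟨rfl, rfl⟩))
      · exact .inr (.inr (.inr ⟨rfl, rfl⟩))

theorem degSum_univ_le_or_eq_coreGraph [Fintype V]
    (hN : ∀ l, IsPathList G l → l.length ≤ 13) (hconn : G.Connected) (hf : IsCycleMap G f)
    (hmax : ∀ l, IsCycleList G l → l.length ≤ 11) {u : V} (hu : ∀ i, f i ≠ u)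
    (hfoot : foot G f u = {0, 2, 4, 6, 8}) :
    degSum G univ + 30 ≤ 10 * Fintype.card V ∨
      ∃ A p q, #A = 5 ∧ p ∉ A ∧ q ∉ A ∧ p ≠ q ∧ G = coreGraph A p q := by
  have hC := card_image_cycle hf
  set A := ({0, 2, 4, 6, 8} : Finset (ZMod 11)).image f with hAdef
  set T₀ := insert u (univ.image f) with hT₀
  have huC : u ∉ univ.image f := by simpa using hu
  have hcardT₀ : #T₀ = 12 := by rw [hT₀, card_insert_of_notMem huC, hC]
  have hA : #A = 5 := by
    rw [hAdef, card_image_of_injective _ hf.1]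
    rfl
  have hmemA : ∀ i, f i ∈ A ↔ i ∈ ({0, 2, 4, 6, 8} : Finset (ZMod 11)) := fun i =>
    hf.1.mem_finset_image
  have hp : f 9 ∉ A := by
    rw [hmemA]
    decide
  have hq : f 10 ∉ A := by
    rw [hmemA]
    decide
  have hpq : f 9 ≠ f 10 := hf.1.ne (by decide)
  have hfT₀ : ∀ i, f i ∈ T₀ := fun i => mem_insert_of_mem (mem_image_of_mem f (mem_univ i))
  have hAT₀ : A ⊆ T₀ := by
    intro x hx
    obtain ⟨i, -, rfl⟩ := mem_image.1 hx
    exact hfT₀ i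
  have hle := coreGraph_adj_of_foot_eq hf hmax hu hfoot
  by_cases hcore : ∀ x ∈ T₀, ∀ y ∈ T₀, (coreGraph A (f 9) (f 10)).Adj x y → G.Adj x y
  · obtain ⟨T, ⟨hT₀T, hT⟩, hTmax⟩ := exists_maximal_nat (f := card) (N := Fintype.card V)
      (P := fun T : Finset V => T₀ ⊆ T ∧
        ∀ x ∈ T, ∀ y ∈ T, G.Adj x y ↔ (coreGraph A (f 9) (f 10)).Adj x y)
      ⟨T₀, Subset.rfl, fun x hx y hy => ⟨hle x hx y hy, hcore x hx y hy⟩⟩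
      fun T _ => card_le_univ T
    have hAT := hAT₀.trans hT₀T
    have hfT : ∀ i, f i ∈ T := fun i => hT₀T (hfT₀ i)
    have hdegT : degSum G T + 28 = 10 * #T := by
      rw [degSum_congr hT]
      exact degSum_coreGraph hA hp hq hpq hAT (hfT 9) (hfT 10)
    have hfew : ∀ w ∉ T, nbrCount G T w < 5 := by
      intro w hw
      by_contra! h5
      have hadj := adj_iff_mem_of_coreGraph hA hp hq hpq hAT (hfT 9) (hfT 10)
        (hcardT₀ ▸ card_le_card hT₀T) (fun x hx y hy => (hT x hx y hy).2) hmax hw h5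
      have hwA : w ∉ A := fun h => hw (hAT h)
      have hwp : w ≠ f 9 := fun h => hw (h ▸ hfT 9)
      have hwq : w ≠ f 10 := fun h => hw (h ▸ hfT 10)
      have hcw : ∀ y ∈ T, (coreGraph A (f 9) (f 10)).Adj w y ↔ y ∈ A := by
        intro y hy
        have hwy : w ≠ y := fun h => hw (h ▸ hy)
        simp [coreGraph_adj, hwy, hwA, hwp, hwq]
      have := hTmax (insert w T) ⟨hT₀T.trans (subset_insert w T), by
        intro x hx y hy
        rcases mem_insert.1 hx with rfl | hx' <;> rcases mem_insert.1 hy with rfl | hy'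
        · simp
        · rw [hadj y hy', hcw y hy']
        · rw [G.adj_comm, (coreGraph A (f 9) (f 10)).adj_comm, hadj x hx', hcw x hx']
        · exact hT x hx' y hy'⟩
      rw [card_insert_of_notMem hw] at this
      omega
    by_cases hTuniv : T = univ
    · right
      refine ⟨A, f 9, f 10, hA, hp, hq, hpq, SimpleGraph.ext (funext₂ fun x y => propext ?_)⟩
      exact hT x (hTuniv ▸ mem_univ x) y (hTuniv ▸ mem_univ y)
    · left
      have hCT : univ.image f ⊆ T := (subset_insert _ _).trans hT₀T
      have := degSum_lt_of_exists_nbrCount_le G 5 T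
        (fun T' hT' => exists_nbrCount_le_five_of_ssubset hN hconn hf hmax hCT (fun z hz => by
          rw [mem_sdiff] at hz
          have hzA : z ∉ A := fun h => hz.2 (image_subset_image (subset_univ _) h)
          rw [← nbrCount_image hf, ← hA]
          refine card_le_card fun a ha => mem_filter.2
            ⟨image_subset_image (subset_univ _) ha, ?_⟩
          exact (hT z hz.1 a (hAT ha)).2 ⟨fun h => hzA (h ▸ ha), .inr (.inl ha)⟩) hT')
        hfew univ (ssubset_univ_iff.2 hTuniv)
      rw [card_univ] at this
      omega
  · left
    push Not at hcore
    obtain ⟨x, hx, y, hy, hxy, hxy'⟩ := hcore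
    have h1 : degSum G T₀ + 2 ≤ degSum (coreGraph A (f 9) (f 10)) T₀ :=
      degSum_add_two_le hle hx hy hxy hxy'
    have h2 := degSum_coreGraph hA hp hq hpq hAT₀ (hfT₀ 9) (hfT₀ 10)
    have h3 := degSum_le_of_exists_nbrCount_le G 5 T₀
      (fun T' hT' => exists_nbrCount_le_five_of_ssubset hN hconn hf hmax (subset_insert _ _)
        (fun z hz => by
          obtain rfl : z = u := by
            rw [mem_sdiff] at hz
            exact (mem_insert.1 hz.1).resolve_right hz.2
          rw [hfoot]
          decide) hT') univ (subset_univ _)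
    rw [card_univ, hcardT₀] at h3
    rw [hcardT₀] at h2
    omega

theorem degSum_univ_le_of_longest_cycle_eleven [Fintype V]
    (hN : ∀ l, IsPathList G l → l.length ≤ 13) (hconn : G.Connected) (hf : IsCycleMap G f)
    (hmax : ∀ l, IsCycleList G l → l.length ≤ 11) :
    degSum G univ ≤ 7 * Fintype.card V + 33 ∨ degSum G univ ≤ 8 * Fintype.card V + 10 ∨
      degSum G univ + 30 ≤ 10 * Fintype.card V ∨
      ∃ A p q, #A = 5 ∧ p ∉ A ∧ q ∉ A ∧ p ≠ q ∧ G = coreGraph A p q := by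
  by_cases hfoot : ∀ u, (∀ i, f i ≠ u) → #(foot G f u) ≤ 4
  · rcases degSum_univ_le_of_foot_le_four hN hconn hf hmax hfoot with h | h
    · exact .inl h
    · exact .inr (.inl h)
  · push Not at hfoot
    obtain ⟨u, hu, h5⟩ := hfoot
    obtain ⟨t, ht⟩ := sparse_eleven _ (foot_add_one_notMem (by norm_num) hf hmax hu) h5
    refine .inr (.inr (degSum_univ_le_or_eq_coreGraph hN hconn (hf.comp_add_left t) hmax
      (fun i => hu (t + i)) ?_))
    ext i
    have h : t + i ∈ foot G f u ↔ i ∈ ({0, 2, 4, 6, 8} : Finset (ZMod 11)) := by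
      rw [ht]
      simp
    rw [← h, mem_foot, mem_foot]

end CycleEleven

section Extremal

theorem nonempty_coreGraph_iso_joinGraph {n : ℕ} {A : Finset (Fin n)} {p q : Fin n}
    (hA : #A = 5) (hp : p ∉ A) (hq : q ∉ A) (hpq : p ≠ q) :
    Nonempty (coreGraph A p q ≃g joinGraph n) := by
  have hlen : (A.toList ++ [p, q]).length = 7 := by simp [hA]
  have hnodup : (A.toList ++ [p, q]).Nodup := by
    rw [List.nodup_append]
    refine ⟨A.nodup_toList, by simpa using hpq, ?_⟩
    intro a ha b hb hab
    rw [mem_toList] at ha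
    simp only [List.mem_cons, List.not_mem_nil, or_false] at hb
    grind
  have hn : 7 ≤ n := by
    simpa [hlen] using hnodup.length_le_card
  obtain ⟨σ, hσ⟩ := Equiv.Perm.exists_extending_pair
    (fun i : Fin 7 => (A.toList ++ [p, q])[i.val]'(by omega)) (Fin.castLE hn)
    (fun i j hij => Fin.ext ((hnodup.getElem_inj_iff).1 hij)) (Fin.castLE_injective hn)
  have hlenA : A.toList.length = 5 := by simp [hA]
  have hσA : ∀ i : Fin 7, i.val < 5 → ∃ a ∈ A, σ a = Fin.castLE hn i := by
    intro i hi
    refine ⟨_, ?_, hσ i⟩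
    rw [List.getElem_append_left (by omega), ← mem_toList]
    exact List.getElem_mem _
  have hσp : (σ p).val = 5 := by
    have := hσ 5
    simp only [List.getElem_append_right (show A.toList.length ≤ ((5 : Fin 7) : ℕ) by
      rw [hlenA]; decide), hlenA] at this
    exact congrArg Fin.val this
  have hσq : (σ q).val = 6 := by
    have := hσ 6
    simp only [List.getElem_append_right (show A.toList.length ≤ ((6 : Fin 7) : ℕ) by
      rw [hlenA]; decide), hlenA] at this
    exact congrArg Fin.val this
  have hmemA : ∀ x, x ∈ A ↔ (σ x).val < 5 := by
    intro x
    constructor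
    · intro hx
      obtain ⟨i, hi, rfl⟩ := List.getElem_of_mem (mem_toList.2 hx)
      have := hσ ⟨i, by omega⟩
      rw [List.getElem_append_left hi] at this
      rw [this]
      simpa using hlenA ▸ hi
    · intro hx
      obtain ⟨a, ha, hax⟩ := hσA ⟨(σ x).val, by omega⟩ hx
      rwa [← σ.injective (hax.trans (Fin.ext rfl) : σ a = σ x)]
  have heqp : ∀ x, x = p ↔ (σ x).val = 5 := fun x => by
    rw [← hσp, Fin.val_inj, σ.apply_eq_iff_eq]
  have heqq : ∀ x, x = q ↔ (σ x).val = 6 := fun x => by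
    rw [← hσq, Fin.val_inj, σ.apply_eq_iff_eq]
  refine ⟨⟨σ, fun {x y} => ?_⟩⟩
  rw [joinGraph, fromRel_adj, coreGraph_adj, σ.injective.ne_iff, hmemA, hmemA, heqp, heqp, heqq,
    heqq]
  refine and_congr_right fun hxy => ?_
  have hxy' : (σ x).val ≠ (σ y).val := fun h => hxy (σ.injective (Fin.ext h))
  omega

theorem degSum_univ_le_or_eq_coreGraph_of_free {V : Type*} [Fintype V] [DecidableEq V]
    {G : SimpleGraph V} [DecidableRel G.Adj] (hn : 14 ≤ Fintype.card V) (hconn : G.Connected)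
    (hfree : ¬ Contains TwoP7 G) :
    degSum G univ + 9 ≤ 9 * Fintype.card V ∨ degSum G univ ≤ 8 * Fintype.card V + 14 ∨
      degSum G univ ≤ 7 * Fintype.card V + 33 ∨ degSum G univ ≤ 6 * Fintype.card V + 58 ∨
      degSum G univ + 30 ≤ 10 * Fintype.card V ∨
      ∃ A p q, #A = 5 ∧ p ∉ A ∧ q ∉ A ∧ p ≠ q ∧ G = coreGraph A p q := by
  have hN : ∀ l, IsPathList G l → l.length ≤ 13 := fun l hl => hl.length_le_thirteen hfree
  by_cases hcyc : ∀ l, IsCycleList G l → l.length ≤ 9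
  · have := hconn.nonempty
    have := degSum_le_of_cycle_length_le (by norm_num) hN hcyc univ univ_nonempty
    rw [card_univ] at this
    exact .inl this
  push Not at hcyc
  obtain ⟨l₀, hl₀, hlen₀⟩ := hcyc
  obtain ⟨l, hl, hmax⟩ := exists_longest ⟨l₀, hl₀⟩ fun l hl => hN l hl.1
  have h13 := hN l hl.1
  have h10 : 10 ≤ l.length := hlen₀.trans_le (hmax l₀ hl₀)
  obtain hc | hc | hc | hc : l.length = 10 ∨ l.length = 11 ∨ l.length = 12 ∨ l.length = 13 := by
    omega
  · obtain ⟨f, hf⟩ := hl.exists_isCycleMap hc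
    rw [hc] at hmax
    have := degSum_univ_le_of_longest_cycle_ten hN hconn hf hmax
    omega
  · obtain ⟨f, hf⟩ := hl.exists_isCycleMap hc
    rw [hc] at hmax
    rcases degSum_univ_le_of_longest_cycle_eleven hN hconn hf hmax with h | h | h | h
    · omega
    · omega
    · omega
    · tauto
  · obtain ⟨f, hf⟩ := hl.exists_isCycleMap hc
    rw [hc] at hmax
    have := degSum_univ_le_of_longest_cycle_twelve hfree hconn hf hmax hn
    omega
  · obtain ⟨f, hf⟩ := hl.exists_isCycleMap hc
    obtain ⟨y, -, hy⟩ := exists_mem_notMem_of_card_lt_card (s := univ.image f) (t := univ) (by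
      rw [card_image_cycle hf, card_univ]
      omega)
    obtain ⟨t, ht⟩ := exists_isTail hconn (y := y) (by simpa using hy)
    have := ht.length_add_le hN hf
    rw [List.length_cons] at this
    omega

theorem bracket_fourteen_seven {n : ℕ} (hn : 14 ≤ n) : ∃ t r c, n = 13 + 6 * t + r ∧
    bracket n 14 7 = 78 + 15 * t + c ∧ (r = 0 ∧ c = 0 ∨ r = 1 ∧ c = 0 ∨ r = 2 ∧ c = 1 ∨
      r = 3 ∧ c = 3 ∨ r = 4 ∧ c = 6 ∨ r = 5 ∧ c = 10) := by
  refine ⟨(n - 13) / 6, (n - 13) % 6, ((n - 13) % 6).choose 2, by omega, ?_, ?_⟩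
  · rw [bracket, if_neg (by omega), mul_comm]
    rfl
  · have : (n - 13) % 6 < 6 := Nat.mod_lt _ (by norm_num)
    interval_cases (n - 13) % 6 <;> simp [Nat.choose]

end Extremal

end

/-- A connected `2P₇`-free graph on `n ≥ 14` vertices has at most
`max {[n,14,7], 5n-14}` edges, with equality only when `n ≥ 22` and
`G ≅ K₅ + (K̄_{n-7} ∪ K₂)`. -/
theorem stmt3 {n : ℕ} (hn : 14 ≤ n) (G : SimpleGraph (Fin n)) (hconn : G.Connected)
    (hfree : ¬ Contains TwoP7 G) :
    G.edgeSet.ncard ≤ max (bracket n 14 7) (5 * n - 14) ∧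
      (G.edgeSet.ncard = max (bracket n 14 7) (5 * n - 14) →
        22 ≤ n ∧ Nonempty (G ≃g joinGraph n)) := by
  classical
  obtain ⟨t, r, c, hnt, hb, hrc⟩ := bracket_fourteen_seven hn
  by_cases hcore : ∃ A p q, A.card = 5 ∧ p ∉ A ∧ q ∉ A ∧ p ≠ q ∧ G = coreGraph A p q
  · obtain ⟨A, p, q, hA, hp, hq, hpq, rfl⟩ := hcore
    have he := degSum_coreGraph hA hp hq hpq (Finset.subset_univ _) (Finset.mem_univ _)
      (Finset.mem_univ _)
    rw [degSum_univ, Finset.card_univ, Fintype.card_fin] at he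
    refine ⟨by omega, fun h => ⟨by omega, nonempty_coreGraph_iso_joinGraph hA hp hq hpq⟩⟩
  · have h := degSum_univ_le_or_eq_coreGraph_of_free (by simpa using hn) hconn hfree
    simp only [hcore, or_false, degSum_univ, Fintype.card_fin] at h
    exact ⟨by omega, fun h => absurd h (by omega)⟩
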